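/- arXiv:2508.02985 — 2 statements merged into one kernel-verified Lean document; each statement's English description precedes it below -/
import Mathlib

section
/- For every integer ℓ ≥ 3, every finite C_{ℓ+1}-free simple graph G with at least one vertex that is not isomorphic to the complete graph K_ℓ and whose chromatic number χ satisfies χ < (5ℓ+2)/3 has chromatic discrepancy φ(G) ≥ χ − ℓ + 1. -/
open SimpleGraph

/-- `σ` is a proper colouring of `G` with colours in `ℕ`. -/
def IsProperColoring {V : Type*} (G : SimpleGraph V) (σ : V → ℕ) : Prop :=
  ∀ ⦃u v : V⦄, G.Adj u v → σ u ≠ σ v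

/-- The chromatic number of `G`, as a natural number. -/
noncomputable def chromNum {V : Type*} (G : SimpleGraph V) : ℕ :=
  sInf {n : ℕ | G.Colorable n}

/-- The discrepancy `φ_σ(G)` of a proper colouring `σ` of `G`: the maximum, over all
induced subgraphs `G[S]` of `G`, of `|σ(S)| - χ(G[S])`. -/
noncomputable def colDisc {V : Type*} (G : SimpleGraph V) (σ : V → ℕ) : ℤ :=
  sSup {z : ℤ | ∃ S : Set V, z = ((σ '' S).ncard : ℤ) - (chromNum (G.induce S) : ℤ)}

/-- The chromatic discrepancy `φ(G)`: the minimum of `φ_σ(G)` over all proper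
colourings `σ` of `G`. -/
noncomputable def chromDisc {V : Type*} (G : SimpleGraph V) : ℤ :=
  sInf {z : ℤ | ∃ σ : V → ℕ, IsProperColoring G σ ∧ z = colDisc G σ}

/-- `G` is locally `s`-colourable: the closed neighbourhood of every vertex induces an
`s`-colourable subgraph. -/
def LocallyColorable {V : Type*} (G : SimpleGraph V) (s : ℕ) : Prop :=
  ∀ v : V, chromNum (G.induce (insert v (G.neighborSet v))) ≤ s

/-- The set of vertices at distance at most `r` from `v` in `G`. -/
def ballSet {V : Type*} (G : SimpleGraph V) (v : V) (r : ℕ) : Set V :=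
  {u : V | ∃ w : G.Walk v u, w.length ≤ r}

/-- `G` is `r`-locally `s`-colourable: every ball of radius `r` induces an
`s`-colourable subgraph. -/
def RLocallyColorable {V : Type*} (G : SimpleGraph V) (r s : ℕ) : Prop :=
  ∀ v : V, chromNum (G.induce (ballSet G v r)) ≤ s

/-- `G` contains no cycle of length exactly `n` as a (not necessarily induced) subgraph. -/
def CycleLenFree {V : Type*} (G : SimpleGraph V) (n : ℕ) : Prop :=
  ∀ (v : V) (w : G.Walk v v), w.IsCycle → w.length ≠ n

/-- `H` is `k`-degenerate: every non-empty (induced) subgraph contains a vertex of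
degree at most `k` in it. -/
def Degenerate {α : Type*} (H : SimpleGraph α) (k : ℕ) : Prop :=
  ∀ S : Set α, S.Nonempty → ∃ a ∈ S, {b | b ∈ S ∧ H.Adj a b}.ncard ≤ k

/-- `G` is co-locally `s`-colourable: for all vertices `u ≠ v`,
`χ(G[{u} ∪ N(v)]) ≤ s`. -/
def CoLocallyColorable {V : Type*} (G : SimpleGraph V) (s : ℕ) : Prop :=
  ∀ v u : V, u ≠ v → chromNum (G.induce (insert u (G.neighborSet v))) ≤ s

/-- The minimum of `χ(G[X])` over all subsets `X ⊆ V(G)` spanning exactly `p` colours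
of `σ` (a rainbow cover of `σ` when `σ` uses exactly `p` colours). -/
noncomputable def minRainbowChrom {V : Type*} (G : SimpleGraph V) (σ : V → ℕ) (p : ℕ) : ℕ :=
  sInf {c : ℕ | ∃ X : Set V, (σ '' X).ncard = p ∧ c = chromNum (G.induce X)}

/-- `f_G(p)`: the maximum, over all proper colourings `σ` of `G` using exactly `p`
colours, of the minimum chromatic number of a rainbow cover of `σ`. -/
noncomputable def fG {V : Type*} (G : SimpleGraph V) (p : ℕ) : ℕ :=
  sSup {m : ℕ | ∃ σ : V → ℕ, IsProperColoring G σ ∧ (σ '' Set.univ).ncard = p ∧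
    m = minRainbowChrom G σ p}

/-- The closed neighbourhood `N[X]` of a set `X` of vertices. -/
def closedNbhd {V : Type*} (G : SimpleGraph V) (X : Set V) : Set V :=
  X ∪ {u : V | ∃ x ∈ X, G.Adj x u}

/-- Colourability of the subgraph induced by a finite set. -/
def ColS {V : Type*} (G : SimpleGraph V) (S : Finset V) (k : ℕ) : Prop :=
  ∃ c : V → ℕ, (∀ v ∈ S, c v < k) ∧ ∀ u ∈ S, ∀ v ∈ S, G.Adj u v → c u ≠ c v

/-- A cycle of length `m` given by an indexing function. -/
def Cyc {V : Type*} (G : SimpleGraph V) (m : ℕ) : Prop :=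
  ∃ g : ℕ → V, (∀ i < m, ∀ j < m, g i = g j → i = j) ∧
    (∀ i, i + 1 < m → G.Adj (g i) (g (i + 1))) ∧ G.Adj (g (m - 1)) (g 0)

/-- A path with `r + 1` vertices in `S`. -/
def Pth {V : Type*} (G : SimpleGraph V) (S : Finset V) (r : ℕ) (f : ℕ → V) : Prop :=
  (∀ i ≤ r, ∀ j ≤ r, f i = f j → i = j) ∧
    (∀ i, i < r → G.Adj (f i) (f (i + 1))) ∧ ∀ i ≤ r, f i ∈ S

lemma exists_walk_of_fun {V : Type*} (G : SimpleGraph V) (g : ℕ → V) (r : ℕ)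
    (h : ∀ i, i < r → G.Adj (g i) (g (i + 1))) :
    ∃ w : G.Walk (g 0) (g r), w.length = r ∧ w.support = (List.range (r + 1)).map g := by
  induction r with
  | zero => exact ⟨Walk.nil, rfl, by simp⟩
  | succ r ih =>
    obtain ⟨w, h1, h2⟩ := ih (fun i hi => h i (by omega))
    refine ⟨w.concat (h r (by omega)), by simp [h1], ?_⟩
    rw [Walk.support_concat, h2, List.range_succ (n := r + 1)]
    simp

lemma cyc_false {V : Type*} (G : SimpleGraph V) (m : ℕ) (hm : 3 ≤ m)
    (hc : CycleLenFree G m) : ¬ Cyc G m := by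
  rintro ⟨g, hi, ha, hl⟩
  obtain ⟨w, h1, h2⟩ := exists_walk_of_fun G g (m - 1) (fun i hi => ha i (by omega))
  have hp : w.IsPath := by
    rw [Walk.isPath_def, h2]
    refine List.Nodup.map_on ?_ List.nodup_range
    intro x hx y hy hxy
    simp only [List.mem_range] at hx hy
    exact hi x (by omega) y (by omega) hxy
  refine hc _ (Walk.cons hl w) ?_ (by simp [h1]; omega)
  rw [Walk.cons_isCycle_iff]
  refine ⟨hp, ?_⟩
  intro he
  have := hp.length_eq_one_of_mem_edges (by simpa [Sym2.eq_swap] using he)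
  omega

section
variable {V : Type*} [Fintype V] (G : SimpleGraph V)

open Classical in
lemma colS_iff (S : Finset V) (k : ℕ) :
    ColS G S k → chromNum (G.induce (S : Set V)) ≤ k := by
  rintro ⟨c, h1, h2⟩
  refine Nat.sInf_le ?_
  refine ⟨Coloring.mk (fun v => (⟨c v.1, h1 v.1 (by simpa using v.2)⟩ : Fin k)) ?_⟩
  intro u v huv h
  simp only [Fin.mk.injEq] at h
  exact h2 u.1 (by simpa using u.2) v.1 (by simpa using v.2) (by simpa using huv) h

lemma colS_univ (k : ℕ) (h : ColS G Finset.univ k) : chromNum G ≤ k := by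
  obtain ⟨c, h1, h2⟩ := h
  refine Nat.sInf_le ?_
  refine ⟨Coloring.mk (fun v => (⟨c v, h1 v (by simp)⟩ : Fin k)) ?_⟩
  intro u v huv h
  simp only [Fin.mk.injEq] at h
  exact h2 u (by simp) v (by simp) huv h

lemma ColS.mono {G : SimpleGraph V} {S : Finset V} {k k' : ℕ} (h : ColS G S k) (hk : k ≤ k') :
    ColS G S k' := by
  obtain ⟨c, h1, h2⟩ := h
  exact ⟨c, fun v hv => lt_of_lt_of_le (h1 v hv) hk, h2⟩

lemma exists_code (X : Finset V) :
    ∃ c : V → ℕ, (∀ v ∈ X, c v < X.card) ∧ Set.InjOn c X := by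
  classical
  refine ⟨fun v => if h : v ∈ X then (X.equivFin ⟨v, h⟩ : ℕ) else 0, ?_, ?_⟩
  · intro v hv
    simp [hv]
  · intro u hu v hv h
    simp only [Finset.mem_coe] at hu hv
    simp only [hu, hv, dite_true] at h
    have := X.equivFin.injective (Fin.ext h)
    simpa using this

/-- Two non-adjacent vertices save a colour. -/
lemma colS_nonadj (X : Finset V) (a b : V) (ha : a ∈ X) (hb : b ∈ X) (hab : a ≠ b)
    (hn : ¬ G.Adj a b) : ColS G X (X.card - 1) := by
  classical
  obtain ⟨c, h1, h2⟩ := exists_code (X.erase b)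
  rw [Finset.card_erase_of_mem hb] at h1
  refine ⟨fun v => if v = b then c a else c v, ?_, ?_⟩
  · intro v hv
    by_cases h : v = b
    · simp only [h, if_true]; exact h1 a (by simp [ha, hab])
    · simp only [h, if_false]; exact h1 v (by simp [hv, h])
  · intro u hu v hv huv
    have hne := huv.ne
    by_cases h : u = b <;> by_cases h' : v = b
    · subst h; subst h'; exact absurd rfl hne
    · subst h
      simp only [if_true, h', if_false]
      intro he
      have := h2 (by simp [ha, hab]) (by simp [hv, h']) he
      subst this; exact hn huv.symm
    · subst h'
      simp only [if_true, h, if_false]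
      intro he
      have := h2 (by simp [hu, h]) (by simp [ha, hab]) he
      subst this; exact hn huv
    · simp only [h', h, if_false]
      intro he
      exact hne (h2 (by simp [hu, h]) (by simp [hv, h']) he)

open Classical in
lemma exists_crit (X : Finset V) (k : ℕ) (h : ¬ ColS G X k) :
    ∃ S ⊆ X, ¬ ColS G S k ∧ ∀ v ∈ S, k ≤ (S.filter (G.Adj v)).card := by
  induction X using Finset.strongInduction with
  | H X ih =>
    by_cases hX : ∀ v ∈ X, k ≤ (X.filter (G.Adj v)).card
    · exact ⟨X, subset_rfl, h, hX⟩
    · push Not at hX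
      obtain ⟨v, hv, hd⟩ := hX
      have hcol : ¬ ColS G (X.erase v) k := by
        rintro ⟨c, h1, h2⟩
        apply h
        have : ∃ d ∈ Finset.range k, d ∉ (X.filter (G.Adj v)).image c := by
          apply Finset.exists_mem_notMem_of_card_lt_card
          rw [Finset.card_range]
          exact lt_of_le_of_lt Finset.card_image_le hd
        obtain ⟨d, hd1, hd2⟩ := this
        simp only [Finset.mem_image, Finset.mem_filter, not_exists, not_and, and_imp] at hd2
        refine ⟨fun u => if u = v then d else c u, ?_, ?_⟩
        · intro u hu
          by_cases h : u = v
          · simpa [h] using hd1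
          · simpa [h] using h1 u (by simp [hu, h])
        · intro a ha b hb hab
          have hne := hab.ne
          by_cases h : a = v <;> by_cases h' : b = v
          · subst h; subst h'; exact absurd rfl hne
          · subst h
            simp only [if_true, h', if_false]
            exact fun e => hd2 b hb hab e.symm
          · subst h'
            simp only [if_true, h, if_false]
            exact fun e => hd2 a ha hab.symm e
          · simp only [h', h, if_false]
            exact h2 a (by simp [ha, h]) b (by simp [hb, h']) hab
      obtain ⟨S, hS, h1, h2⟩ := ih _ (Finset.erase_ssubset hv) hcol
      exact ⟨S, hS.trans (Finset.erase_subset _ _), h1, h2⟩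

lemma pth_card (S : Finset V) (r : ℕ) (f : ℕ → V) (h : Pth G S r f) : r + 1 ≤ S.card := by
  classical
  have : ((Finset.range (r + 1)).image f).card = r + 1 := by
    rw [Finset.card_image_of_injOn, Finset.card_range]
    intro i hi j hj hij
    simp at hi hj
    exact h.1 i (by omega) j (by omega) hij
  rw [← this]
  apply Finset.card_le_card
  intro x hx
  simp at hx
  obtain ⟨i, hi, rfl⟩ := hx
  exact h.2.2 i (by omega)

lemma exists_longest (S : Finset V) (hS : S.Nonempty) :
    ∃ r f, Pth G S r f ∧ ∀ r' f', Pth G S r' f' → r' ≤ r := by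
  classical
  obtain ⟨x, hx⟩ := hS
  have h0 : ∃ r, ∃ f, Pth G S r f := ⟨0, fun _ => x, by
    refine ⟨by intros; omega, by intros; omega, fun _ _ => hx⟩⟩
  have hb : ∀ r, (∃ f, Pth G S r f) → r ≤ S.card := fun r ⟨f, hf⟩ => by
    have := pth_card G S r f hf; omega
  have hfin : {r | ∃ f, Pth G S r f}.Finite := (Set.finite_Iic S.card).subset hb
  obtain ⟨r, ⟨f, hf⟩, hmax⟩ := hfin.exists_maximalFor id _ h0
  refine ⟨r, f, hf, fun r' f' h' => ?_⟩
  by_contra hlt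
  push Not at hlt
  exact absurd (hmax (j := r') ⟨f', h'⟩ (by simp; omega)) (by simp; omega)

/-- In a longest path all the neighbours of the first vertex are on the path. -/
lemma longest_nbr (S : Finset V) (r : ℕ) (f : ℕ → V) (h : Pth G S r f)
    (hmax : ∀ r' f', Pth G S r' f' → r' ≤ r) (x : V) (hx : x ∈ S) (hax : G.Adj (f 0) x) :
    ∃ i, 1 ≤ i ∧ i ≤ r ∧ f i = x := by
  by_contra hcon
  push Not at hcon
  have hne : ∀ i ≤ r, f i ≠ x := by
    intro i hi
    rcases Nat.eq_zero_or_pos i with h0 | h0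
    · subst h0; exact hax.ne
    · exact hcon i h0 hi
  have := hmax (r + 1) (fun i => if i = 0 then x else f (i - 1)) ⟨?_, ?_, ?_⟩
  · omega
  · intro i hi j hj
    by_cases hi0 : i = 0 <;> by_cases hj0 : j = 0
    · intros; omega
    · simp only [hi0, hj0, if_true, if_false]
      intro e; exact absurd e.symm (hne _ (by omega))
    · simp only [hi0, hj0, if_true, if_false]
      intro e; exact absurd e (hne _ (by omega))
    · simp only [hi0, hj0, if_false]
      intro e; have := h.1 _ (by omega) _ (by omega) e; omega
  · intro i hi
    by_cases hi0 : i = 0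
    · simp [hi0]; exact hax.symm
    · simp only [hi0, if_false, Nat.succ_ne_zero, Nat.add_sub_cancel]
      have := h.2.1 (i - 1) (by omega)
      rwa [Nat.sub_add_cancel (by omega)] at this
  · intro i hi
    by_cases hi0 : i = 0
    · simp [hi0, hx]
    · simp only [hi0, if_false]; exact h.2.2 _ (by omega)

/-- No `K_k`, no path with `k + 1` vertices: `(k-1)`-colourable. -/
lemma exists_clique (S : Finset V) (k : ℕ) (hk : 1 ≤ k) (hP : ∀ f, ¬ Pth G S k f)
    (hcol : ¬ ColS G S (k - 1)) :
    ∃ C ⊆ S, C.card = k ∧ ∀ u ∈ C, ∀ v ∈ C, u ≠ v → G.Adj u v := by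
  classical
  obtain ⟨T, hTS, hT, hdeg⟩ := exists_crit G S (k - 1) hcol
  have hTne : T.Nonempty := by
    rw [Finset.nonempty_iff_ne_empty]
    rintro rfl
    exact hT ⟨fun _ => 0, by simp, by simp⟩
  obtain ⟨r, f, hf, hmax⟩ := exists_longest G T hTne
  have hrk : r < k := by
    by_contra hlt
    push Not at hlt
    exact hP f ⟨fun i hi j hj => hf.1 i (by omega) j (by omega),
      fun i hi => hf.2.1 i (by omega), fun i hi => hTS (hf.2.2 i (by omega))⟩
  have key : ∀ f', Pth G T r f' → r = k - 1 ∧ ∀ i, 1 ≤ i → i ≤ r → G.Adj (f' 0) (f' i) := by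
    intro f' hf'
    have hsub : T.filter (G.Adj (f' 0)) ⊆ (Finset.Icc 1 r).image f' := by
      intro x hx
      simp only [Finset.mem_filter] at hx
      obtain ⟨i, h1, h2, h3⟩ := longest_nbr G T r f' hf' hmax x hx.1 hx.2
      simp only [Finset.mem_image, Finset.mem_Icc]
      exact ⟨i, ⟨h1, h2⟩, h3⟩
    have hc1 : ((Finset.Icc 1 r).image f').card ≤ r := by
      refine Finset.card_image_le.trans (by simp)
    have hd := hdeg (f' 0) (hf'.2.2 0 (by omega))
    have hle := Finset.card_le_card hsub
    refine ⟨by omega, ?_⟩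
    have heq := Finset.eq_of_subset_of_card_le hsub (by omega)
    intro i h1 h2
    have : f' i ∈ T.filter (G.Adj (f' 0)) := by
      rw [heq]; simp only [Finset.mem_image, Finset.mem_Icc]; exact ⟨i, ⟨h1, h2⟩, rfl⟩
    simpa using (Finset.mem_filter.1 this).2
  have hr := (key f hf).1
  have h0 := (key f hf).2
  have hlt : ∀ i j, i < j → j ≤ r → G.Adj (f i) (f j) := by
    intro i j hij hj
    have hp : Pth G T r (fun a => f (if a ≤ i then i - a else a)) := by
      refine ⟨?_, ?_, ?_⟩
      · intro a ha b hb e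
        have := hf.1 _ (by split_ifs <;> omega) _ (by split_ifs <;> omega) e
        split_ifs at this <;> omega
      · intro a ha
        rcases lt_trichotomy a i with h | h | h
        · simp only [h.le, if_true, Nat.succ_le_of_lt h]
          have := hf.2.1 (i - (a + 1)) (by omega)
          rw [show i - (a + 1) + 1 = i - a by omega] at this
          exact this.symm
        · subst h
          simpa using h0 (a + 1) (by omega) (by omega)
        · simp only [show ¬ a ≤ i by omega, show ¬ a + 1 ≤ i by omega, if_false]
          exact hf.2.1 a ha
      · intro a ha; exact hf.2.2 _ (by split_ifs <;> omega)
    have := (key _ hp).2 j (by omega) hj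
    simpa [show ¬ j ≤ i by omega] using this
  refine ⟨(Finset.range (r + 1)).image f, ?_, ?_, ?_⟩
  · intro x hx
    simp at hx
    obtain ⟨i, hi, rfl⟩ := hx
    exact hTS (hf.2.2 i (by omega))
  · rw [Finset.card_image_of_injOn, Finset.card_range]
    · omega
    · intro i hi j hj hij
      simp at hi hj
      exact hf.1 i (by omega) j (by omega) hij
  · intro u hu v hv huv
    simp at hu hv
    obtain ⟨i, hi, rfl⟩ := hu
    obtain ⟨j, hj, rfl⟩ := hv
    rcases lt_trichotomy i j with h | h | h
    · exact hlt i j h (by omega)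
    · subst h; exact absurd rfl huv
    · exact (hlt j i h (by omega)).symm
end

section
variable {V : Type*} [Fintype V] (G : SimpleGraph V)

lemma pth_reverse (S : Finset V) (r : ℕ) (f : ℕ → V) (h : Pth G S r f) :
    Pth G S r (fun i => f (r - i)) := by
  refine ⟨?_, ?_, ?_⟩
  · intro i hi j hj e
    have := h.1 _ (by omega) _ (by omega) e
    omega
  · intro i hi
    have := h.2.1 (r - (i + 1)) (by omega)
    rw [show r - (i + 1) + 1 = r - i by omega] at this
    exact this.symm
  · intro i hi; exact h.2.2 _ (by omega)

open Classical in
/-- Dirac's theorem, for induced subgraphs. -/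
lemma exists_ham (S : Finset V) (δ : ℕ) (hS : S.Nonempty) (hδ : 1 ≤ δ)
    (hdeg : ∀ v ∈ S, δ ≤ (S.filter (G.Adj v)).card) (hn : S.card ≤ 2 * δ) :
    ∃ g : ℕ → V, (∀ i < S.card, ∀ j < S.card, g i = g j → i = j) ∧
      (∀ i, i + 1 < S.card → G.Adj (g i) (g (i + 1))) ∧ G.Adj (g (S.card - 1)) (g 0) ∧
      ∀ i < S.card, g i ∈ S := by
  obtain ⟨r, f, hf, hmax⟩ := exists_longest G S hS
  have hcard := pth_card G S r f hf
  have hA : δ ≤ ((Finset.range r).filter (fun i => G.Adj (f 0) (f (i + 1)))).card := by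
    refine (hdeg (f 0) (hf.2.2 0 (by omega))).trans ?_
    have : S.filter (G.Adj (f 0)) ⊆
        ((Finset.range r).filter (fun i => G.Adj (f 0) (f (i + 1)))).image (fun i => f (i + 1)) := by
      intro x hx
      simp only [Finset.mem_filter] at hx
      obtain ⟨i, h1, h2, h3⟩ := longest_nbr G S r f hf hmax x hx.1 hx.2
      simp only [Finset.mem_image, Finset.mem_filter, Finset.mem_range]
      refine ⟨i - 1, ⟨by omega, ?_⟩, ?_⟩
      · rw [Nat.sub_add_cancel h1, h3]; exact hx.2
      · rw [Nat.sub_add_cancel h1, h3]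
    exact (Finset.card_le_card this).trans Finset.card_image_le
  have hB : δ ≤ ((Finset.range r).filter (fun i => G.Adj (f r) (f i))).card := by
    refine (hdeg (f r) (hf.2.2 r (by omega))).trans ?_
    have : S.filter (G.Adj (f r)) ⊆
        ((Finset.range r).filter (fun i => G.Adj (f r) (f i))).image f := by
      intro x hx
      simp only [Finset.mem_filter] at hx
      obtain ⟨i, h1, h2, h3⟩ := longest_nbr G S r _ (pth_reverse G S r f hf) hmax x hx.1
        (by simpa using hx.2)
      simp only [Finset.mem_image, Finset.mem_filter, Finset.mem_range]
      refine ⟨r - i, ⟨by omega, ?_⟩, h3⟩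
      · rw [h3]; exact hx.2
    exact (Finset.card_le_card this).trans Finset.card_image_le
  have hAB : ∃ i, i < r ∧ G.Adj (f 0) (f (i + 1)) ∧ G.Adj (f r) (f i) := by
    by_contra hcon
    push Not at hcon
    have hdis : Disjoint ((Finset.range r).filter (fun i => G.Adj (f 0) (f (i + 1))))
        ((Finset.range r).filter (fun i => G.Adj (f r) (f i))) := by
      rw [Finset.disjoint_left]
      intro i hi hi'
      simp only [Finset.mem_filter, Finset.mem_range] at hi hi'
      exact hcon i hi.1 hi.2 hi'.2
    have := Finset.card_union_of_disjoint hdis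
    have h2 : (((Finset.range r).filter (fun i => G.Adj (f 0) (f (i + 1)))) ∪
        ((Finset.range r).filter (fun i => G.Adj (f r) (f i)))).card ≤ r := by
      refine (Finset.card_le_card (t := Finset.range r) ?_).trans (by simp)
      exact Finset.union_subset (Finset.filter_subset _ _) (Finset.filter_subset _ _)
    omega
  obtain ⟨s, hs, hs1, hs2⟩ := hAB
  -- the cycle
  set g : ℕ → V := fun i => f (if i ≤ s then i else r + s + 1 - i) with hg
  have ginj : ∀ i < r + 1, ∀ j < r + 1, g i = g j → i = j := by
    intro i hi j hj e
    have := hf.1 _ (by split_ifs <;> omega) _ (by split_ifs <;> omega) e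
    split_ifs at this <;> omega
  have gadj : ∀ i, i + 1 < r + 1 → G.Adj (g i) (g (i + 1)) := by
    intro i hi
    rcases lt_trichotomy i s with h | h | h
    · simp only [hg, h.le, if_true, Nat.succ_le_of_lt h]
      exact hf.2.1 i (by omega)
    · subst h
      simp only [hg, le_refl, if_true, show ¬ i + 1 ≤ i by omega, if_false]
      rw [show r + i + 1 - (i + 1) = r by omega]
      exact hs2.symm
    · simp only [hg, show ¬ i ≤ s by omega, show ¬ i + 1 ≤ s by omega, if_false]
      have := hf.2.1 (r + s + 1 - (i + 1)) (by omega)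
      rw [show r + s + 1 - (i + 1) + 1 = r + s + 1 - i by omega] at this
      exact this.symm
  have gcl : G.Adj (g r) (g 0) := by
    simp only [hg, show ¬ r ≤ s by omega, if_false, Nat.zero_le, if_true]
    rw [show r + s + 1 - r = s + 1 by omega]
    exact hs1.symm
  have gS : ∀ i < r + 1, g i ∈ S := fun i hi => hf.2.2 _ (by split_ifs <;> omega)
  have hrn : r + 1 = S.card := by
    by_contra hne
    have himc : ((Finset.range (r + 1)).image g).card = r + 1 := by
      rw [Finset.card_image_of_injOn, Finset.card_range]
      intro i hi j hj hij
      simp at hi hj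
      exact ginj i (by omega) j (by omega) hij
    obtain ⟨x, hx, hx'⟩ := Finset.exists_mem_notMem_of_card_lt_card
      (s := (Finset.range (r + 1)).image g) (t := S) (by omega)
    have hrδ : δ ≤ r := hA.trans ((Finset.card_filter_le _ _).trans (by simp))
    have : ∃ i < r + 1, G.Adj x (g i) := by
      by_contra hcon
      push Not at hcon
      have hsub : S.filter (G.Adj x) ⊆ S \ ((Finset.range (r + 1)).image g) := by
        intro y hy
        simp only [Finset.mem_filter] at hy
        simp only [Finset.mem_sdiff, Finset.mem_image, Finset.mem_range, not_exists, not_and]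
        refine ⟨hy.1, ?_⟩
        rintro i hi rfl
        exact hcon i hi hy.2
      have h1 := Finset.card_le_card hsub
      have h2 := hdeg x hx
      rw [Finset.card_sdiff_of_subset, himc] at h1
      · omega
      · intro y hy
        simp at hy
        obtain ⟨i, hi, rfl⟩ := hy
        exact gS i (by omega)
    obtain ⟨a, ha, hxa⟩ := this
    have hxg : ∀ i < r + 1, g i ≠ x := by
      intro i hi e
      exact hx' (by simp only [Finset.mem_image, Finset.mem_range]; exact ⟨i, hi, e⟩)
    set e : ℕ → ℕ := fun i => if i = 0 then 0 else if a + i - 1 ≤ r then a + i - 1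
      else a + i - 1 - (r + 1) with he
    have heL : ∀ i, i ≤ r + 1 → e i < r + 1 := by
      intro i hi; simp only [he]; split_ifs <;> omega
    have := hmax (r + 1) (fun i => if i = 0 then x else g (e i)) ⟨?_, ?_, ?_⟩
    · omega
    · intro i hi j hj
      by_cases hi0 : i = 0 <;> by_cases hj0 : j = 0
      · intros; omega
      · simp only [hi0, hj0, if_true, if_false]
        intro e; exact absurd e.symm (hxg _ (heL _ hj))
      · simp only [hi0, hj0, if_true, if_false]
        intro e; exact absurd e (hxg _ (heL _ hi))
      · simp only [hi0, hj0, if_false]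
        intro hh
        have := ginj _ (heL _ hi) _ (heL _ hj) hh
        simp only [he, hi0, hj0, if_false] at this
        split_ifs at this <;> omega
    · intro i hi
      by_cases hi0 : i = 0
      · subst hi0
        simp only [if_true, Nat.zero_add, one_ne_zero, if_false]
        have : e 1 = a := by simp [he]; omega
        rw [this]; exact hxa
      · simp only [hi0, if_false, Nat.succ_ne_zero]
        rcases lt_trichotomy (a + i - 1) r with h | h | h
        · have h1 : e i = a + i - 1 := by simp only [he]; split_ifs <;> omega
          have h2 : e (i + 1) = a + i - 1 + 1 := by simp only [he]; split_ifs <;> omega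
          rw [h1, h2]; exact gadj _ (by omega)
        · have h1 : e i = r := by simp only [he]; split_ifs <;> omega
          have h2 : e (i + 1) = 0 := by simp only [he]; split_ifs <;> omega
          rw [h1, h2]; exact gcl
        · have h1 : e i = a + i - 1 - (r + 1) := by simp only [he]; split_ifs <;> omega
          have h2 : e (i + 1) = a + i - 1 - (r + 1) + 1 := by simp only [he]; split_ifs <;> omega
          rw [h1, h2]; exact gadj _ (by omega)
    · intro i hi
      by_cases hi0 : i = 0
      · simp [hi0, hx]
      · simp only [hi0, if_false]; exact gS _ (heL _ hi)
  rw [← hrn]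
  exact ⟨g, ginj, gadj, gcl, gS⟩

/-- every vertex of `S` is on a hamiltonian cycle of `S` -/
lemma ham_surj (S : Finset V) (g : ℕ → V) (hinj : ∀ i < S.card, ∀ j < S.card, g i = g j → i = j)
    (hS : ∀ i < S.card, g i ∈ S) (x : V) (hx : x ∈ S) : ∃ i < S.card, g i = x := by
  classical
  have himc : ((Finset.range S.card).image g).card = S.card := by
    rw [Finset.card_image_of_injOn, Finset.card_range]
    intro i hi j hj hij
    simp at hi hj
    exact hinj i (by omega) j (by omega) hij
  have hsub : (Finset.range S.card).image g ⊆ S := by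
    intro y hy
    simp at hy
    obtain ⟨i, hi, rfl⟩ := hy
    exact hS i hi
  have := Finset.eq_of_subset_of_card_le hsub (by omega)
  rw [← this] at hx
  simpa using hx

open Classical in
/-- Bondy's argument. -/
lemma bondy (S : Finset V) (δ m : ℕ) (hm : 3 ≤ m) (hmn : m ≤ S.card)
    (hdeg : ∀ v ∈ S, δ ≤ (S.filter (G.Adj v)).card) (hn : S.card < 2 * δ)
    (g : ℕ → V) (ginj : ∀ i < S.card, ∀ j < S.card, g i = g j → i = j)
    (gadj : ∀ i, i + 1 < S.card → G.Adj (g i) (g (i + 1)))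
    (gcl : G.Adj (g (S.card - 1)) (g 0)) (gS : ∀ i < S.card, g i ∈ S) : Cyc G m := by
  by_contra hcyc
  set n := S.card with hnn
  set J := (Finset.Icc 1 (n - 2)).filter (fun j => G.Adj (g 0) (g j)) with hJ
  set I := (Finset.Icc 1 (n - 2)).filter (fun j => G.Adj (g (n - 1)) (g j)) with hI
  have hJc : δ ≤ J.card + 1 := by
    refine (hdeg (g 0) (gS 0 (by omega))).trans ?_
    have : S.filter (G.Adj (g 0)) ⊆ insert (g (n - 1)) (J.image g) := by
      intro x hx
      simp only [Finset.mem_filter] at hx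
      obtain ⟨i, hi, rfl⟩ := ham_surj S g ginj gS x hx.1
      have hi0 : i ≠ 0 := by rintro rfl; exact hx.2.ne rfl
      by_cases h : i = n - 1
      · simp [h]
      · apply Finset.mem_insert_of_mem
        apply Finset.mem_image_of_mem
        simp only [hJ, Finset.mem_filter, Finset.mem_Icc]
        exact ⟨⟨by omega, by omega⟩, hx.2⟩
    refine (Finset.card_le_card this).trans ((Finset.card_insert_le _ _).trans ?_)
    exact Nat.add_le_add_right Finset.card_image_le 1
  have hIc : δ ≤ I.card + 1 := by
    refine (hdeg (g (n - 1)) (gS (n - 1) (by omega))).trans ?_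
    have : S.filter (G.Adj (g (n - 1))) ⊆ insert (g 0) (I.image g) := by
      intro x hx
      simp only [Finset.mem_filter] at hx
      obtain ⟨i, hi, rfl⟩ := ham_surj S g ginj gS x hx.1
      have hi0 : i ≠ n - 1 := by rintro rfl; exact hx.2.ne rfl
      by_cases h : i = 0
      · simp [h]
      · apply Finset.mem_insert_of_mem
        apply Finset.mem_image_of_mem
        simp only [hI, Finset.mem_filter, Finset.mem_Icc]
        exact ⟨⟨by omega, by omega⟩, hx.2⟩
    refine (Finset.card_le_card this).trans ((Finset.card_insert_le _ _).trans ?_)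
    exact Nat.add_le_add_right Finset.card_image_le 1
  set π : ℕ → ℕ := fun j => if j ≤ n - m + 1 then j + m - 3 else j - (n - m + 1) with hπ
  have hπc : (J.image π).card = J.card := by
    apply Finset.card_image_of_injOn
    intro a ha b hb e
    simp only [hJ, Finset.coe_filter, Finset.mem_Icc, Set.mem_setOf_eq] at ha hb
    simp only [hπ] at e
    split_ifs at e <;> omega
  have hdis : Disjoint (J.image π) I := by
    rw [Finset.disjoint_left]
    intro i hi hi'
    simp only [Finset.mem_image] at hi
    obtain ⟨j, hj, rfl⟩ := hi
    simp only [hJ, hI, Finset.mem_filter, Finset.mem_Icc] at hj hi'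
    obtain ⟨⟨hj1, hj2⟩, hj3⟩ := hj
    obtain ⟨⟨hi1, hi2⟩, hi3⟩ := hi'
    apply hcyc
    by_cases hc : j ≤ n - m + 1
    · have hpj : π j = j + m - 3 := by simp [hπ, hc]
      rw [hpj] at hi1 hi2 hi3
      refine ⟨fun i => g (if i = 0 then 0 else if i = m - 1 then n - 1 else j + i - 1), ?_, ?_, ?_⟩
      · intro a ha b hb e
        have := ginj _ (by split_ifs <;> omega) _ (by split_ifs <;> omega) e
        split_ifs at this <;> omega
      · intro a ha
        by_cases h0 : a = 0
        · subst h0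
          simp only [if_true, Nat.zero_add, one_ne_zero, if_false, show ¬ (1 = m - 1) by omega,
            Nat.add_sub_cancel]
          exact hj3
        · by_cases h1 : a + 1 = m - 1
          · simp only [h0, if_false, h1, if_true, show ¬ (a = m - 1) by omega,
              show m - 1 ≠ 0 by omega]
            rw [show j + a - 1 = j + m - 3 by omega]
            exact hi3.symm
          · simp only [h0, if_false, h1, show ¬ (a = m - 1) by omega, show a + 1 ≠ 0 by omega]
            rw [show j + (a + 1) - 1 = j + a - 1 + 1 by omega]
            exact gadj _ (by omega)
      · simp only [show m - 1 ≠ 0 by omega, if_false, if_true]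
        exact gcl
    · have hpj : π j = j - (n - m + 1) := by simp [hπ, hc]
      rw [hpj] at hi1 hi2 hi3
      set q := j - (n - m + 1) with hq
      refine ⟨fun i => g (if i ≤ q then i else n - 1 - (i - (q + 1))), ?_, ?_, ?_⟩
      · intro a ha b hb e
        have := ginj _ (by split_ifs <;> omega) _ (by split_ifs <;> omega) e
        split_ifs at this <;> omega
      · intro a ha
        rcases lt_trichotomy a q with h | h | h
        · simp only [h.le, if_true, Nat.succ_le_of_lt h]
          exact gadj a (by omega)
        · simp only [h, le_refl, if_true, show ¬ q + 1 ≤ q by omega, if_false, Nat.sub_self,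
            Nat.sub_zero]
          exact hi3.symm
        · simp only [show ¬ a ≤ q by omega, show ¬ a + 1 ≤ q by omega, if_false]
          have := gadj (n - 1 - (a + 1 - (q + 1))) (by omega)
          rw [show n - 1 - (a + 1 - (q + 1)) + 1 = n - 1 - (a - (q + 1)) by omega] at this
          exact this.symm
      · simp only [show ¬ m - 1 ≤ q by omega, if_false, Nat.zero_le, if_true]
        rw [show n - 1 - (m - 1 - (q + 1)) = j by omega]
        exact hj3.symm
  have h1 := Finset.card_union_of_disjoint hdis
  have h2 : (J.image π ∪ I).card ≤ n - 2 := by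
    refine (Finset.card_le_card (t := Finset.Icc 1 (n - 2)) ?_).trans (by simp)
    refine Finset.union_subset ?_ (Finset.filter_subset _ _)
    intro i hi
    simp only [Finset.mem_image] at hi
    obtain ⟨j, hj, rfl⟩ := hi
    simp only [hJ, Finset.mem_filter, Finset.mem_Icc] at hj
    simp only [Finset.mem_Icc, hπ]
    split_ifs <;> omega
  omega

lemma cyc4 (a b c d : V) (h1 : G.Adj a b) (h2 : G.Adj b c) (h3 : G.Adj c d) (h4 : G.Adj d a)
    (hac : a ≠ c) (hbd : b ≠ d) : Cyc G 4 := by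
  refine ⟨fun i => if i = 0 then a else if i = 1 then b else if i = 2 then c else d, ?_, ?_, ?_⟩
  · have := h1.ne; have := h2.ne; have := h3.ne; have := h4.ne
    intro i hi j hj
    interval_cases i <;> interval_cases j <;> simp <;> grind
  · intro i hi
    have : i < 3 := by omega
    interval_cases i <;> simpa
  · simpa

lemma cyc5 (a b c d e : V) (h1 : G.Adj a b) (h2 : G.Adj b c) (h3 : G.Adj c d) (h4 : G.Adj d e)
    (h5 : G.Adj e a)
    (hac : a ≠ c) (had : a ≠ d) (hbd : b ≠ d) (hbe : b ≠ e) (hce : c ≠ e) : Cyc G 5 := by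
  refine ⟨fun i => if i = 0 then a else if i = 1 then b else if i = 2 then c else
    if i = 3 then d else e, ?_, ?_, ?_⟩
  · have := h1.ne; have := h2.ne; have := h3.ne; have := h4.ne; have := h5.ne
    intro i hi j hj
    interval_cases i <;> interval_cases j <;> simp <;> grind
  · intro i hi
    have : i < 4 := by omega
    interval_cases i <;> simpa
  · simpa

lemma ham_periodic (n : ℕ) (hn : 1 ≤ n) (g : ℕ → V)
    (ginj : ∀ i < n, ∀ j < n, g i = g j → i = j)
    (gadj : ∀ i, i + 1 < n → G.Adj (g i) (g (i + 1)))
    (gcl : G.Adj (g (n - 1)) (g 0)) :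
    (∀ i j, g (i % n) = g (j % n) → i % n = j % n) ∧
    (∀ i, G.Adj (g (i % n)) (g ((i + 1) % n))) := by
  have hpos : ∀ i, i % n < n := fun i => Nat.mod_lt _ hn
  refine ⟨fun i j h => ginj _ (hpos i) _ (hpos j) h, fun i => ?_⟩
  have h1 := hpos i
  by_cases h : i % n + 1 < n
  · have := gadj _ h
    rwa [show (i + 1) % n = i % n + 1 by rw [← Nat.mod_add_mod, Nat.mod_eq_of_lt h]]
  · have h2 : i % n = n - 1 := by omega
    have h3 : (i + 1) % n = 0 := by
      rw [← Nat.mod_add_mod, h2, Nat.sub_add_cancel hn, Nat.mod_self]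
    rw [h2, h3]; exact gcl

open Classical in
lemma special6 (S : Finset V) (hS6 : S.card = 6)
    (hdeg : ∀ v ∈ S, 3 ≤ (S.filter (G.Adj v)).card)
    (g : ℕ → V) (ginj : ∀ i < S.card, ∀ j < S.card, g i = g j → i = j)
    (gadj : ∀ i, i + 1 < S.card → G.Adj (g i) (g (i + 1)))
    (gcl : G.Adj (g (S.card - 1)) (g 0)) (gS : ∀ i < S.card, g i ∈ S) : Cyc G 4 := by
  by_contra hcyc
  have hsurj := ham_surj S g ginj gS
  rw [hS6] at *
  obtain ⟨hi, ha⟩ := ham_periodic G 6 (by omega) g ginj gadj gcl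
  set h : ℕ → V := fun i => g (i % 6) with hh
  have hi' : ∀ i j, i % 6 ≠ j % 6 → h i ≠ h j := fun i j hne e => hne (hi i j e)
  have hper : ∀ i, h (i + 6) = h i := fun i => by simp [hh]
  have ha' : ∀ i, G.Adj (h i) (h (i + 1)) := ha
  have d3 : ∀ i, ¬ G.Adj (h i) (h (i + 3)) := fun i hadj =>
    hcyc (cyc4 G (h i) (h (i + 1)) (h (i + 2)) (h (i + 3)) (ha' _) (ha' _) (ha' _) hadj.symm
      (hi' _ _ (by omega)) (hi' _ _ (by omega)))
  have hd : ∀ x, G.Adj (h x) (h (x + 2)) ∨ G.Adj (h x) (h (x + 4)) := by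
    intro x
    by_contra hcon
    push Not at hcon
    have hsub : S.filter (G.Adj (h x)) ⊆ {h (x + 1), h (x + 5)} := by
      intro y hy
      simp only [Finset.mem_filter] at hy
      obtain ⟨i, hi6, rfl⟩ := hsurj y hy.1
      have : ∃ k < 6, g i = h (x + k) := by
        refine ⟨(i + 6 - x % 6) % 6, Nat.mod_lt _ (by omega), ?_⟩
        simp only [hh]; congr 1; omega
      obtain ⟨k, hk, hk'⟩ := this
      rw [hk'] at hy ⊢
      have := hy.2
      interval_cases k
      · exact absurd rfl this.ne
      · simp
      · exact absurd this hcon.1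
      · exact absurd this (d3 _)
      · exact absurd this hcon.2
      · simp
    have h1 := Finset.card_le_card hsub
    have h2 := hdeg (h x) (gS _ (Nat.mod_lt _ (by omega)))
    have h3 := Finset.card_le_two (a := h (x + 1)) (b := h (x + 5))
    omega
  have d2 : ∀ i, ¬ G.Adj (h i) (h (i + 2)) := by
    intro i hadj
    rcases hd (i + 1) with hx | hx
    · exact hcyc (cyc4 G (h i) (h (i + 2)) (h (i + 3)) (h (i + 1)) hadj (ha' _) hx.symm
        (ha' _).symm (hi' _ _ (by omega)) (hi' _ _ (by omega)))
    · have h6 := ha' (i + 5)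
      rw [hper] at h6
      exact hcyc (cyc4 G (h (i + 1)) (h (i + 5)) (h i) (h (i + 2)) hx h6 hadj
        (ha' _).symm (hi' _ _ (by omega)) (hi' _ _ (by omega)))
  rcases hd 0 with hx | hx
  · exact d2 0 hx
  · have := d2 4
    rw [show 4 + 2 = 0 + 6 from rfl, hper] at this
    exact this hx.symm

open Classical in
lemma special8 (S : Finset V) (hS8 : S.card = 8) (hcol : ¬ ColS G S 2)
    (hdeg : ∀ v ∈ S, 4 ≤ (S.filter (G.Adj v)).card)
    (g : ℕ → V) (ginj : ∀ i < S.card, ∀ j < S.card, g i = g j → i = j)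
    (gadj : ∀ i, i + 1 < S.card → G.Adj (g i) (g (i + 1)))
    (gcl : G.Adj (g (S.card - 1)) (g 0)) (gS : ∀ i < S.card, g i ∈ S) : Cyc G 5 := by
  by_contra hcyc
  have hsurj := ham_surj S g ginj gS
  rw [hS8] at *
  obtain ⟨hi, ha⟩ := ham_periodic G 8 (by omega) g ginj gadj gcl
  set h : ℕ → V := fun i => g (i % 8) with hh
  have hi' : ∀ i j, i % 8 ≠ j % 8 → h i ≠ h j := fun i j hne e => hne (hi i j e)
  have hper : ∀ i, h (i + 8) = h i := fun i => by simp [hh]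
  have ha' : ∀ i, G.Adj (h i) (h (i + 1)) := ha
  have hrep : ∀ x, ∀ y ∈ S, ∃ k < 8, y = h (x + k) := by
    intro x y hy
    obtain ⟨i, hi8, rfl⟩ := hsurj y hy
    refine ⟨(i + 8 - x % 8) % 8, Nat.mod_lt _ (by omega), ?_⟩
    simp only [hh]; congr 1; omega
  have d4 : ∀ i, ¬ G.Adj (h i) (h (i + 4)) := fun i hadj =>
    hcyc (cyc5 G (h i) (h (i + 1)) (h (i + 2)) (h (i + 3)) (h (i + 4)) (ha' _) (ha' _) (ha' _)
      (ha' _) hadj.symm (hi' _ _ (by omega)) (hi' _ _ (by omega)) (hi' _ _ (by omega))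
      (hi' _ _ (by omega)) (hi' _ _ (by omega)))
  have hd : ∀ x, ¬ G.Adj (h x) (h (x + 3)) → ¬ G.Adj (h x) (h (x + 5)) →
      G.Adj (h x) (h (x + 2)) ∧ G.Adj (h x) (h (x + 6)) := by
    intro x h3 h5
    have hsub : S.filter (G.Adj (h x)) ⊆
        (({1, 2, 6, 7} : Finset ℕ).filter (fun k => G.Adj (h x) (h (x + k)))).image
          (fun k => h (x + k)) := by
      intro y hy
      simp only [Finset.mem_filter] at hy
      obtain ⟨k, hk, hk'⟩ := hrep x y hy.1
      rw [hk'] at hy ⊢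
      have := hy.2
      apply Finset.mem_image_of_mem (fun k => h (x + k))
      rw [Finset.mem_filter]
      refine ⟨?_, this⟩
      interval_cases k
      · exact absurd rfl this.ne
      · simp
      · simp
      · exact absurd this h3
      · exact absurd this (d4 _)
      · exact absurd this h5
      · simp
      · simp
    have h1 := (Finset.card_le_card hsub).trans Finset.card_image_le
    have h2 := hdeg (h x) (gS _ (Nat.mod_lt _ (by omega)))
    have h4 : ({1, 2, 6, 7} : Finset ℕ).card = 4 := rfl
    have := Finset.eq_of_subset_of_card_le (Finset.filter_subset
      (fun k => G.Adj (h x) (h (x + k))) ({1, 2, 6, 7} : Finset ℕ)) (by omega)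
    rw [Finset.filter_eq_self] at this
    exact ⟨this 2 (by simp), this 6 (by simp)⟩
  have d2 : ∀ i, ¬ G.Adj (h i) (h (i + 2)) := by
    intro i hadj
    have h7 := ha' (i + 7)
    rw [hper] at h7
    have n74 : ¬ G.Adj (h (i + 4)) (h (i + 4 + 3)) := fun hx =>
      hcyc (cyc5 G (h i) (h (i + 2)) (h (i + 3)) (h (i + 4)) (h (i + 7)) hadj (ha' _) (ha' _) hx
        h7 (hi' _ _ (by omega)) (hi' _ _ (by omega)) (hi' _ _ (by omega))
        (hi' _ _ (by omega)) (hi' _ _ (by omega)))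
    have n14 : ¬ G.Adj (h (i + 1)) (h (i + 1 + 3)) := fun hx =>
      hcyc (cyc5 G (h i) (h (i + 2)) (h (i + 3)) (h (i + 4)) (h (i + 1)) hadj (ha' _) (ha' _)
        hx.symm (ha' _).symm (hi' _ _ (by omega)) (hi' _ _ (by omega)) (hi' _ _ (by omega))
        (hi' _ _ (by omega)) (hi' _ _ (by omega)))
    have n16 : ¬ G.Adj (h (i + 1)) (h (i + 1 + 5)) := fun hx =>
      hcyc (cyc5 G (h i) (h (i + 2)) (h (i + 1)) (h (i + 6)) (h (i + 7)) hadj (ha' _).symm hx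
        (ha' _) h7 (hi' _ _ (by omega)) (hi' _ _ (by omega)) (hi' _ _ (by omega))
        (hi' _ _ (by omega)) (hi' _ _ (by omega)))
    have n41 : ¬ G.Adj (h (i + 4)) (h (i + 4 + 5)) := fun hx => n14 (by
      rw [show i + 4 + 5 = i + 1 + 8 by omega, hper] at hx
      exact hx.symm)
    have h13 := (hd _ n14 n16).1
    have h42 := (hd _ n74 n41).2
    rw [show i + 4 + 6 = i + 2 + 8 by omega, hper] at h42
    exact hcyc (cyc5 G (h i) (h (i + 1)) (h (i + 3)) (h (i + 4)) (h (i + 2)) (ha' _) h13 (ha' _)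
        h42 hadj.symm (hi' _ _ (by omega)) (hi' _ _ (by omega)) (hi' _ _ (by omega))
        (hi' _ _ (by omega)) (hi' _ _ (by omega)))
  have hpar : ∀ i k, G.Adj (h i) (h (i + k)) → k < 8 → k % 2 = 1 := by
    intro i k hadj hk
    interval_cases k
    · exact absurd rfl hadj.ne
    · rfl
    · exact absurd hadj (d2 _)
    · rfl
    · exact absurd hadj (d4 _)
    · rfl
    · have := d2 (i + 6)
      rw [show i + 6 + 2 = i + 8 by omega, hper] at this
      exact absurd hadj.symm this
    · rfl
  apply hcol
  have hex : ∀ y, ∃ k, y ∈ S → y = h k := by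
    intro y
    by_cases hy : y ∈ S
    · obtain ⟨k, _, hk⟩ := hrep 0 y hy
      exact ⟨0 + k, fun _ => hk⟩
    · exact ⟨0, fun h => absurd h hy⟩
  choose idx hidx using hex
  refine ⟨fun y => idx y % 2, fun v _ => Nat.mod_lt _ (by omega), ?_⟩
  intro u hu v hv huv e
  obtain ⟨k, hk, hk'⟩ := hrep (idx u) v hv
  have hv' := hidx v hv
  have hu' := hidx u hu
  rw [hu', hk'] at huv
  have h1 := hpar _ _ huv hk
  have h2 : (idx u + k) % 8 = idx v % 8 := hi _ _ (by
    change h _ = h _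
    rw [← hk', ← hv'])
  simp only at e
  omega

/-- A graph on fewer than `5m/3` vertices with chromatic number at least `m` has an `m`-cycle. -/
lemma dense_cyc (X : Finset V) (m : ℕ) (hm : 4 ≤ m) (hX : 3 * X.card < 5 * m)
    (hcol : ¬ ColS G X (m - 1)) : Cyc G m := by
  classical
  obtain ⟨S, hSX, hS, hdeg⟩ := exists_crit G X (m - 1) hcol
  have hSne : S.Nonempty := by
    rw [Finset.nonempty_iff_ne_empty]
    rintro rfl
    exact hS ⟨fun _ => 0, by simp, by simp⟩
  have hcard := Finset.card_le_card hSX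
  have hmS : m ≤ S.card := by
    obtain ⟨v, hv⟩ := hSne
    have h1 := hdeg v hv
    have h2 : S.filter (G.Adj v) ⊆ S.erase v := by
      intro x hx
      simp only [Finset.mem_filter] at hx
      simp only [Finset.mem_erase]
      exact ⟨hx.2.ne', hx.1⟩
    have h3 := Finset.card_le_card h2
    rw [Finset.card_erase_of_mem hv] at h3
    have := Finset.card_pos.2 ⟨v, hv⟩
    omega
  obtain ⟨g, h1, h2, h3, h4⟩ := exists_ham G S (m - 1) hSne (by omega) hdeg (by omega)
  by_cases hlt : S.card < 2 * (m - 1)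
  · exact bondy G S (m - 1) m (by omega) hmS hdeg hlt g h1 h2 h3 h4
  · have : m = 4 ∨ m = 5 := by omega
    rcases this with rfl | rfl
    · exact special6 G S (by omega) hdeg g h1 h2 h3 h4
    · exact special8 G S (by omega) (fun h => hS (h.mono (by omega))) hdeg g h1 h2 h3 h4
end

section
variable {V : Type*} [Fintype V] (G : SimpleGraph V)

/-- `C` is a clique with `k` vertices. -/
def Clq {V : Type*} (G : SimpleGraph V) (C : Finset V) (k : ℕ) : Prop :=
  C.card = k ∧ ∀ u ∈ C, ∀ v ∈ C, u ≠ v → G.Adj u v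

lemma clique_ext (K : Finset V) (ℓ : ℕ) (hK : Clq G K ℓ) (x a b : V)
    (hx : x ∉ K) (ha : a ∈ K) (hb : b ∈ K) (hab : a ≠ b) (hxa : G.Adj x a) (hxb : G.Adj x b) :
    Cyc G (ℓ + 1) := by
  classical
  obtain ⟨hcard, hcl⟩ := hK
  set L0 := ((K.erase a).erase b).toList with hL0
  set M := a :: (L0 ++ [b]) with hM
  have hmem : ∀ y ∈ M, y ∈ K := by
    intro y hy
    simp only [hM, hL0, List.mem_cons, List.mem_append, Finset.mem_toList, Finset.mem_erase,
      List.not_mem_nil, or_false] at hy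
    rcases hy with rfl | hy | rfl
    · exact ha
    · exact hy.2.2
    · exact hb
  have hnd : M.Nodup := by
    have h0 : L0.Nodup := Finset.nodup_toList _
    have h1 : a ∉ L0 := by simp [hL0]
    have h2 : b ∉ L0 := by simp [hL0]
    simp only [hM, List.nodup_cons, List.mem_append, List.mem_singleton, List.nodup_append]
    refine ⟨by tauto, h0, by simp, ?_⟩
    rintro y hy z rfl rfl
    exact h2 hy
  have hlen : M.length = ℓ := by
    have h2 : b ∈ K.erase a := by simp [hb, hab.symm]
    have hc := Finset.card_erase_of_mem h2
    have hc' := Finset.card_erase_of_mem ha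
    have hp : 1 ≤ (K.erase a).card := Finset.card_pos.2 ⟨b, h2⟩
    simp only [hM, hL0, List.length_cons, List.length_append, Finset.length_toList,
      List.length_nil]
    omega
  have hl2 : 2 ≤ ℓ := by rw [← hlen]; simp [hM]
  have hget : ∀ i < ℓ, M.getD i x ∈ K := by
    intro i hi
    rw [List.getD_eq_getElem _ _ (by omega)]
    exact hmem _ (List.getElem_mem _)
  have hinj : ∀ i < ℓ, ∀ j < ℓ, M.getD i x = M.getD j x → i = j := by
    intro i hi j hj e
    rw [List.getD_eq_getElem _ _ (by omega), List.getD_eq_getElem _ _ (by omega)] at e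
    exact (List.Nodup.getElem_inj_iff hnd).1 e
  refine ⟨fun i => if i = 0 then x else M.getD (i - 1) x, ?_, ?_, ?_⟩
  · intro i hi j hj
    by_cases hi0 : i = 0 <;> by_cases hj0 : j = 0
    · intros; omega
    · simp only [hi0, hj0, if_true, if_false]
      intro e; rw [e] at hx; exact absurd (hget _ (by omega)) hx
    · simp only [hi0, hj0, if_true, if_false]
      intro e; rw [← e] at hx; exact absurd (hget _ (by omega)) hx
    · simp only [hi0, hj0, if_false]
      intro e; have := hinj _ (by omega) _ (by omega) e; omega
  · intro i hi
    by_cases hi0 : i = 0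
    · subst hi0; simp [hM, hxa]
    · simp only [hi0, if_false, Nat.succ_ne_zero, Nat.add_sub_cancel]
      apply hcl _ (hget _ (by omega)) _ (hget _ (by omega))
      intro e
      have := hinj _ (by omega) _ (by omega) e; omega
  · simp only [Nat.add_sub_cancel, show ℓ ≠ 0 by omega, if_false, if_true]
    have : M.getD (ℓ - 1) x = b := by
      rw [List.getD_eq_getElem _ _ (by omega)]
      have h3 : ℓ - 1 = L0.length + 1 := by
        simp [hM] at hlen; omega
      simp [hM, h3]
    rw [this]; exact hxb.symm

/-- path with `ℓ` vertices in the neighbourhood of `v` gives a cycle -/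
lemma path_nbhd (S : Finset V) (v : V) (hS : ∀ x ∈ S, G.Adj v x) (r : ℕ) (f : ℕ → V)
    (hf : Pth G S r f) : Cyc G (r + 2) := by
  have hne : ∀ i ≤ r, f i ≠ v := fun i hi e => (hS _ (hf.2.2 i hi)).ne e.symm
  refine ⟨fun i => if i = 0 then v else f (i - 1), ?_, ?_, ?_⟩
  · intro i hi j hj
    by_cases hi0 : i = 0 <;> by_cases hj0 : j = 0
    · intros; omega
    · simp only [hi0, hj0, if_true, if_false]
      intro e; exact absurd e.symm (hne _ (by omega))
    · simp only [hi0, hj0, if_true, if_false]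
      intro e; exact absurd e (hne _ (by omega))
    · simp only [hi0, hj0, if_false]
      intro e; have := hf.1 _ (by omega) _ (by omega) e; omega
  · intro i hi
    by_cases hi0 : i = 0
    · subst hi0; simp; exact hS _ (hf.2.2 0 (by omega))
    · simp only [hi0, if_false, Nat.succ_ne_zero, Nat.add_sub_cancel]
      have := hf.2.1 (i - 1) (by omega)
      rwa [Nat.sub_add_cancel (by omega)] at this
  · simp
    exact (hS _ (hf.2.2 r (by omega))).symm

/-- Recolouring: every colour class of an optimal colouring has a vertex seeing all colours. -/
lemma exists_bvertex (σ : V → ℕ) (hσ : IsProperColoring G σ) (P : Finset ℕ)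
    (hP : ∀ v, σ v ∈ P) (hcol : ¬ ColS G Finset.univ (P.card - 1)) (c : ℕ) (hc : c ∈ P) :
    ∃ v, σ v = c ∧ ∀ d ∈ P, d ≠ c → ∃ x, G.Adj v x ∧ σ x = d := by
  classical
  by_contra hcon
  push Not at hcon
  have hex : ∀ v, ∃ d, d ∈ P ∧ d ≠ c ∧ (σ v = c → ∀ x, G.Adj v x → σ x ≠ d) ∧
      (σ v ≠ c → d = σ v) := by
    intro v
    by_cases h : σ v = c
    · obtain ⟨d, h1, h2, h3⟩ := hcon v h
      exact ⟨d, h1, h2, fun _ => h3, fun h' => absurd h h'⟩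
    · exact ⟨σ v, hP v, h, fun h' => absurd h' h, fun _ => rfl⟩
  choose τ h1 h2 h3 h4 using hex
  apply hcol
  obtain ⟨e, he1, he2⟩ : ∃ e : ℕ → ℕ, (∀ v ∈ P.erase c, e v < (P.erase c).card) ∧
      Set.InjOn e (P.erase c) := by
    refine ⟨fun v => if h : v ∈ P.erase c then ((P.erase c).equivFin ⟨v, h⟩ : ℕ) else 0, ?_, ?_⟩
    · intro v hv
      simp only [hv, dite_true]
      exact Fin.is_lt _
    · intro u hu v hv h
      rw [Finset.mem_coe] at hu hv
      simp only [hu, hv, dite_true] at h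
      have := (P.erase c).equivFin.injective (Fin.ext h)
      simpa using this
  rw [Finset.card_erase_of_mem hc] at he1
  have hmem : ∀ v, τ v ∈ P.erase c := fun v => by simp [h1 v, h2 v]
  refine ⟨fun v => e (τ v), fun v _ => he1 _ (hmem v), ?_⟩
  intro u _ v _ huv e'
  have heq := he2 (hmem u) (hmem v) e'
  by_cases hu : σ u = c <;> by_cases hv : σ v = c
  · exact hσ huv (hu.trans hv.symm)
  · rw [h4 v hv] at heq
    exact h3 u hu v huv heq.symm
  · rw [h4 u hu] at heq
    exact h3 v hv u huv.symm heq
  · rw [h4 u hu, h4 v hv] at heq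
    exact hσ huv heq

/-- Colourings valued in a finite set of colours. -/
lemma colS_of_colors (τ : V → ℕ) (hτ : IsProperColoring G τ) (P : Finset ℕ)
    (hP : ∀ v, τ v ∈ P) : ColS G Finset.univ P.card := by
  classical
  refine ⟨fun v => (P.equivFin ⟨τ v, hP v⟩ : ℕ), fun v _ => Fin.is_lt _, ?_⟩
  intro u _ v _ huv h
  have := P.equivFin.injective (Fin.ext h)
  exact hτ huv (by simpa using this)

/-- Two uniquely coloured vertices of an `ℓ`-clique contradict optimality. -/
lemma unique_pair (ℓ : ℕ) (hno : ¬ Cyc G (ℓ + 1)) (σ : V → ℕ) (hσ : IsProperColoring G σ)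
    (P : Finset ℕ) (hP : ∀ v, σ v ∈ P) (hcol : ¬ ColS G Finset.univ (P.card - 1))
    (K : Finset V) (hK : Clq G K ℓ) (hlt : ℓ < P.card) (v w : V) (hv : v ∈ K) (hw : w ∈ K)
    (hvw : v ≠ w) (huv : ∀ x, σ x = σ v → x = v) (huw : ∀ x, σ x = σ w → x = w) : False := by
  classical
  obtain ⟨j, hjP, hjK⟩ := Finset.exists_mem_notMem_of_card_lt_card
    (s := K.image σ) (t := P) (by
      refine lt_of_le_of_lt Finset.card_image_le ?_
      rw [hK.1]; exact hlt)
  have hjK' : ∀ x ∈ K, σ x ≠ j := fun x hx e => hjK (by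
    simp only [Finset.mem_image]; exact ⟨x, hx, e⟩)
  have hσvw : σ v ≠ σ w := fun e => hvw (huw v e)
  have hN : ∀ x, G.Adj w x → σ x = j → ¬ G.Adj v x := by
    intro x hx hj hvx
    have hxK : x ∉ K := fun h => hjK' x h hj
    exact hno (clique_ext G K ℓ hK x v w hxK hv hw hvw hvx.symm hx.symm)
  apply hcol
  rw [← Finset.card_erase_of_mem (hP w)]
  set τ : V → ℕ := fun x => if x = w then j else if G.Adj w x ∧ σ x = j then σ v else σ x with hτ
  refine colS_of_colors G τ ?_ _ ?_
  · -- properness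
    have aux : ∀ a b, G.Adj a b → a = w → τ a ≠ τ b := by
      rintro a b hab rfl
      have hb : b ≠ a := hab.ne'
      simp only [hτ, if_true, hb, if_false]
      by_cases h : σ b = j
      · simp only [hab, h, and_self, if_true]
        exact (hjK' v hv).symm
      · simp only [h, and_false, if_false]
        exact fun e => h e.symm
    have aux2 : ∀ a b, G.Adj a b → a ≠ w → b ≠ w → (G.Adj w a ∧ σ a = j) → τ a ≠ τ b := by
      intro a b hab ha hb hc
      simp only [hτ, ha, hb, if_false, hc, and_self, if_true]
      by_cases h : G.Adj w b ∧ σ b = j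
      · exact absurd (hc.2.trans h.2.symm) (hσ hab)
      · simp only [h, if_false]
        intro e
        have := huv b e.symm
        subst this
        exact hN a hc.1 hc.2 hab.symm
    intro a b hab
    by_cases ha : a = w
    · exact aux a b hab ha
    by_cases hb : b = w
    · exact (aux b a hab.symm hb).symm
    by_cases hca : G.Adj w a ∧ σ a = j
    · exact aux2 a b hab ha hb hca
    by_cases hcb : G.Adj w b ∧ σ b = j
    · exact (aux2 b a hab.symm hb ha hcb).symm
    simp only [hτ, ha, hb, hca, hcb, if_false]
    exact hσ hab
  · intro x
    rw [Finset.mem_erase]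
    by_cases hx : x = w
    · simp only [hτ, hx, if_true]
      exact ⟨(hjK' w hw).symm, hjP⟩
    by_cases hc : G.Adj w x ∧ σ x = j
    · simp only [hτ, hx, hc, and_self, if_true, if_false]
      exact ⟨hσvw, hP v⟩
    · simp only [hτ, hx, hc, if_false]
      exact ⟨fun e => hx (huw x e), hP x⟩

/-- Choice of a suitable vertex `v`. -/
lemma exists_good_vertex (ℓ : ℕ) (hno : ¬ Cyc G (ℓ + 1)) (σ : V → ℕ) (hσ : IsProperColoring G σ)
    (P : Finset ℕ) (hP : ∀ v, σ v ∈ P) (hcol : ¬ ColS G Finset.univ (P.card - 1))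
    (hlt : ℓ < P.card) (hℓ : 1 ≤ ℓ) :
    ∃ v, (∀ d ∈ P, d ≠ σ v → ∃ x, G.Adj v x ∧ σ x = d) ∧
      ∀ C, Clq G C (ℓ - 1) → (∀ x ∈ C, G.Adj v x) → ∀ w ∈ C, ∃ u, u ≠ w ∧ σ u = σ w := by
  classical
  by_cases hu : ∃ v, ∀ x, σ x = σ v → x = v
  · obtain ⟨v, hv⟩ := hu
    obtain ⟨v', h1, h2⟩ := exists_bvertex G σ hσ P hP hcol (σ v) (hP v)
    have := hv v' h1
    subst this
    refine ⟨v', h2, fun C hC hCv w hw => ?_⟩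
    by_contra hcon
    push Not at hcon
    have hvC : v' ∉ C := fun h => (hCv v' h).ne rfl
    refine unique_pair G ℓ hno σ hσ P hP hcol (insert v' C) ⟨?_, ?_⟩ hlt v' w (by simp)
      (by simp [hw]) (fun e => hvC (e ▸ hw)) hv ?_
    · rw [Finset.card_insert_of_notMem hvC, hC.1]; omega
    · intro a ha b hb hab
      rw [Finset.mem_insert] at ha hb
      rcases ha with rfl | ha <;> rcases hb with rfl | hb
      · exact absurd rfl hab
      · exact hCv b hb
      · exact (hCv a ha).symm
      · exact hC.2 a ha b hb hab
    · intro x hx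
      by_contra hne
      exact hcon x hne hx
  · push Not at hu
    obtain ⟨c, hc⟩ : P.Nonempty := Finset.card_pos.1 (by omega)
    obtain ⟨v, h1, h2⟩ := exists_bvertex G σ hσ P hP hcol c hc
    refine ⟨v, by rw [h1]; exact h2, fun C _ _ w _ => ?_⟩
    obtain ⟨u, h3, h4⟩ := hu w
    exact ⟨u, h4, h3⟩
end

section
variable {V : Type*} [Fintype V] (G : SimpleGraph V)

open Classical in
/-- `S` is a rainbow transversal of all colours but `σ v` inside the neighbourhood of `v`. -/
def Trv {V : Type*} (G : SimpleGraph V) (σ : V → ℕ) (P : Finset ℕ) (v : V) (S : Finset V) : Prop :=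
  (∀ x ∈ S, G.Adj v x) ∧ (∀ x ∈ S, ∀ y ∈ S, σ x = σ y → x = y) ∧
    ∀ d, (∃ x ∈ S, σ x = d) ↔ (d ∈ P ∧ d ≠ σ v)

/-- `C` is a clique of size `k` inside the neighbourhood of `v`. -/
def NClq {V : Type*} (G : SimpleGraph V) (v : V) (k : ℕ) (C : Finset V) : Prop :=
  Clq G C k ∧ ∀ x ∈ C, G.Adj v x

lemma nclq_eq (ℓ : ℕ) (hℓ : 3 ≤ ℓ) (hno : ¬ Cyc G (ℓ + 1)) (v : V) (C D : Finset V)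
    (hC : NClq G v (ℓ - 1) C) (hD : NClq G v (ℓ - 1) D) (y : V) (hyC : y ∈ C) (hyD : y ∈ D) :
    C = D := by
  classical
  by_contra hne
  have hex : ∃ x ∈ D, x ∉ C := by
    by_contra h
    push Not at h
    exact hne (Finset.eq_of_subset_of_card_le h (by rw [hC.1.1, hD.1.1])).symm
  obtain ⟨x, hxD, hxC⟩ := hex
  have hvC : v ∉ C := fun h => (hC.2 v h).ne rfl
  refine hno (clique_ext G (insert v C) ℓ ⟨?_, ?_⟩ x v y ?_ (by simp) (by simp [hyC]) ?_ ?_ ?_)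
  · rw [Finset.card_insert_of_notMem hvC, hC.1.1]; omega
  · intro a ha b hb hab
    rw [Finset.mem_insert] at ha hb
    rcases ha with rfl | ha
    · rcases hb with rfl | hb
      · exact absurd rfl hab
      · exact hC.2 _ hb
    · rcases hb with rfl | hb
      · exact (hC.2 _ ha).symm
      · exact hC.1.2 _ ha _ hb hab
  · rw [Finset.mem_insert]
    rintro (h | h)
    · exact (hD.2 x hxD).ne h.symm
    · exact hxC h
  · exact (hC.2 y hyC).ne
  · exact (hD.2 x hxD).symm
  · exact hD.1.2 _ hxD _ hyD (fun h => hxC (h ▸ hyC))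

open Classical in
lemma fgen (ℓ : ℕ) (hℓ : 3 ≤ ℓ) (hno : ¬ Cyc G (ℓ + 1)) (σ : V → ℕ)
    (P : Finset ℕ) (v : V)
    (hbad : ∀ X : Finset V, (∀ d ∈ P, ∃ x ∈ X, σ x = d) → ¬ ColS G X (ℓ - 1))
    (S A T : Finset V) (hS : Trv G σ P v S)
    (hA : ∀ w ∈ A, ∃ u ∈ T, σ u = σ w) (hT : ∀ u ∈ T, ¬ G.Adj v u)
    (hTT : ∀ u ∈ T, ∀ b ∈ T, ¬ G.Adj u b) :
    ∃ C ⊆ S \ A, NClq G v (ℓ - 1) C := by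
  by_contra hcon
  have hcol : ColS G (S \ A) (ℓ - 1 - 1) := by
    by_contra hcol
    obtain ⟨C, hC, h1, h2⟩ := exists_clique G (S \ A) (ℓ - 1) (by omega) (by
      intro f hf
      have := path_nbhd G (S \ A) v (fun x hx => hS.1 x (Finset.sdiff_subset hx)) _ f hf
      rw [show ℓ - 1 + 2 = ℓ + 1 by omega] at this
      exact hno this) hcol
    exact hcon ⟨C, hC, ⟨h1, h2⟩, fun x hx => hS.1 x (Finset.sdiff_subset (hC hx))⟩
  obtain ⟨c, hc1, hc2⟩ := hcol
  refine hbad ((S \ A) ∪ insert v T) ?_ ⟨fun x => if x ∈ S \ A then c x else ℓ - 2, ?_, ?_⟩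
  · intro d hd
    by_cases hdv : d = σ v
    · exact ⟨v, by simp, hdv.symm⟩
    · obtain ⟨x, hx, hxd⟩ := (hS.2.2 d).2 ⟨hd, hdv⟩
      by_cases hxA : x ∈ A
      · obtain ⟨u, hu, hux⟩ := hA x hxA
        exact ⟨u, by simp [hu], hux.trans hxd⟩
      · exact ⟨x, by simp [hx, hxA], hxd⟩
  · intro x hx
    dsimp only
    split_ifs with h
    · have := hc1 x h; omega
    · omega
  · have key : ∀ x ∈ insert v T, ∀ y ∈ insert v T, ¬ G.Adj x y := by
      intro x hx y hy hxy
      rw [Finset.mem_insert] at hx hy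
      rcases hx with rfl | hx
      · rcases hy with rfl | hy
        · exact hxy.ne rfl
        · exact hT y hy hxy
      · rcases hy with rfl | hy
        · exact hT x hx hxy.symm
        · exact hTT x hx y hy hxy
    intro x hx y hy hxy
    dsimp only
    rw [Finset.mem_union] at hx hy
    split_ifs with h1 h2 h2
    · exact hc2 x h1 y h2 hxy
    · have := hc1 x h1; omega
    · have := hc1 y h2; omega
    · exact absurd hxy (key x (hx.resolve_left h1) y (hy.resolve_left h2))

open Classical in
lemma trv_swap (σ : V → ℕ) (P : Finset ℕ) (v : V) (S : Finset V) (hS : Trv G σ P v S)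
    (w u : V) (hw : w ∈ S) (hu : G.Adj v u) (huw : σ u = σ w) :
    Trv G σ P v (insert u (S.erase w)) := by
  obtain ⟨h1, h2, h3⟩ := hS
  refine ⟨?_, ?_, ?_⟩
  · intro x hx
    simp only [Finset.mem_insert, Finset.mem_erase] at hx
    rcases hx with rfl | hx
    · exact hu
    · exact h1 x hx.2
  · intro x hx y hy hxy
    simp only [Finset.mem_insert, Finset.mem_erase] at hx hy
    rcases hx with rfl | hx <;> rcases hy with rfl | hy
    · rfl
    · exact absurd (h2 _ hy.2 _ hw (by rw [← hxy, huw])) hy.1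
    · exact absurd (h2 _ hx.2 _ hw (by rw [hxy, huw])) hx.1
    · exact h2 _ hx.2 _ hy.2 hxy
  · intro d
    rw [← h3 d]
    constructor
    · rintro ⟨x, hx, rfl⟩
      simp only [Finset.mem_insert, Finset.mem_erase] at hx
      rcases hx with rfl | hx
      · exact ⟨w, hw, huw.symm⟩
      · exact ⟨x, hx.2, rfl⟩
    · rintro ⟨x, hx, rfl⟩
      by_cases h : x = w
      · exact ⟨u, by simp, by rw [huw, h]⟩
      · exact ⟨x, by simp [hx, h], rfl⟩

lemma trv_card (σ : V → ℕ) (P : Finset ℕ) (v : V) (hv : σ v ∈ P) (S : Finset V)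
    (hS : Trv G σ P v S) : S.card + 1 = P.card := by
  classical
  have : S.image σ = P.erase (σ v) := by
    ext d
    rw [Finset.mem_image, hS.2.2 d, Finset.mem_erase]
    tauto
  have h2 : (S.image σ).card = S.card := Finset.card_image_of_injOn (fun x hx y hy h => hS.2.1 x hx y hy h)
  rw [← h2, this, Finset.card_erase_of_mem hv]
  have : 0 < P.card := Finset.card_pos.2 ⟨_, hv⟩
  omega

lemma trv_exists (σ : V → ℕ) (P : Finset ℕ) (v : V) (hP : ∀ v, σ v ∈ P) (hσ : IsProperColoring G σ)
    (h : ∀ d ∈ P, d ≠ σ v → ∃ x, G.Adj v x ∧ σ x = d) : ∃ S, Trv G σ P v S := by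
  classical
  haveI : Nonempty V := ⟨v⟩
  choose! g hg using h
  refine ⟨(P.erase (σ v)).image g, ?_, ?_, ?_⟩
  · intro x hx
    simp only [Finset.mem_image, Finset.mem_erase] at hx
    obtain ⟨d, ⟨h1, h2⟩, rfl⟩ := hx
    exact (hg d h2 h1).1
  · intro x hx y hy hxy
    simp only [Finset.mem_image, Finset.mem_erase] at hx hy
    obtain ⟨d, ⟨h1, h2⟩, rfl⟩ := hx
    obtain ⟨e, ⟨h3, h4⟩, rfl⟩ := hy
    rw [(hg d h2 h1).2, (hg e h4 h3).2] at hxy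
    rw [hxy]
  · intro d
    constructor
    · rintro ⟨x, hx, rfl⟩
      simp only [Finset.mem_image, Finset.mem_erase] at hx
      obtain ⟨d, ⟨h1, h2⟩, rfl⟩ := hx
      exact ⟨hP _, fun e => hσ (hg d h2 h1).1 e.symm⟩
    · rintro ⟨h1, h2⟩
      exact ⟨g d, by simp only [Finset.mem_image, Finset.mem_erase]; exact ⟨d, ⟨h2, h1⟩, rfl⟩, (hg d h1 h2).2⟩

end

section
variable {V : Type*} [Fintype V] (G : SimpleGraph V)

open Classical in
lemma lonely_twin (ℓ : ℕ) (hℓ : 3 ≤ ℓ) (hno : ¬ Cyc G (ℓ + 1)) (σ : V → ℕ)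
    (P : Finset ℕ) (v : V)
    (hbad : ∀ X : Finset V, (∀ d ∈ P, ∃ x ∈ X, σ x = d) → ¬ ColS G X (ℓ - 1))
    (htw : ∀ C, NClq G v (ℓ - 1) C → ∀ w ∈ C, ∃ u, u ≠ w ∧ σ u = σ w)
    (S C : Finset V) (hS : Trv G σ P v S) (hCS : C ⊆ S) (hC : NClq G v (ℓ - 1) C)
    (hl : ∀ D ⊆ S \ C, ¬ NClq G v (ℓ - 1) D) (w : V) (hw : w ∈ C) :
    ∃ u C', u ≠ w ∧ σ u = σ w ∧ G.Adj v u ∧ NClq G v (ℓ - 1) C' ∧ u ∈ C' ∧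
      ∀ x ∈ C', x ≠ u → x ∈ S ∧ x ∉ C := by
  obtain ⟨u, huw, hσu⟩ := htw C hC w hw
  have key : ∀ D, D ⊆ S → w ∉ D → ¬ NClq G v (ℓ - 1) D := by
    intro D hDS hwD hD
    refine hl D ?_ hD
    intro x hx
    rw [Finset.mem_sdiff]
    refine ⟨hDS hx, fun hxC => hwD ?_⟩
    rw [nclq_eq G ℓ hℓ hno v D C hD hC x hx hxC]
    exact hw
  have hvu : G.Adj v u := by
    by_contra hvu
    obtain ⟨D, hDS, hD⟩ := fgen G ℓ hℓ hno σ P v hbad S {w} {u} hS (by simp [hσu])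
      (by simpa using hvu) (by simp)
    refine key D (fun x hx => (Finset.mem_sdiff.1 (hDS hx)).1) (fun h => ?_) hD
    simpa using (Finset.mem_sdiff.1 (hDS h)).2
  obtain ⟨C', hC'S, hC'⟩ := fgen G ℓ hℓ hno σ P v hbad _ ∅ ∅
    (trv_swap G σ P v S hS w u (hCS hw) hvu hσu) (by simp) (by simp) (by simp)
  have hmem : ∀ x ∈ C', x ≠ u → x ∈ S ∧ x ≠ w := by
    intro x hx hxu
    have := hC'S hx
    simp only [Finset.mem_sdiff, Finset.mem_insert, Finset.mem_erase] at this
    tauto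
  have hwC' : w ∉ C' := fun h => (hmem w h huw.symm).2 rfl
  have huC' : u ∈ C' := by
    by_contra huC'
    exact key C' (fun x hx => (hmem x hx (fun h => huC' (h ▸ hx))).1) hwC' hC'
  refine ⟨u, C', huw, hσu, hvu, hC', huC', fun x hx hxu => ⟨(hmem x hx hxu).1, fun hxC => ?_⟩⟩
  rw [nclq_eq G ℓ hℓ hno v C' C hC' hC x hx hxC] at hwC'
  exact hwC' hw

open Classical in
lemma case_one (ℓ t : ℕ) (hℓ : 3 ≤ ℓ) (ht : 3 * t ≤ 2 * ℓ + 1) (hno : ¬ Cyc G (ℓ + 1)) (σ : V → ℕ)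
    (P : Finset ℕ) (v : V) (hP : ∀ v, σ v ∈ P) (hPc : P.card = ℓ + t)
    (hbad : ∀ X : Finset V, (∀ d ∈ P, ∃ x ∈ X, σ x = d) → ¬ ColS G X (ℓ - 1))
    (htw : ∀ C, NClq G v (ℓ - 1) C → ∀ w ∈ C, ∃ u, u ≠ w ∧ σ u = σ w)
    (S C : Finset V) (hS : Trv G σ P v S) (hCS : C ⊆ S) (hC : NClq G v (ℓ - 1) C)
    (hl : ∀ D ⊆ S \ C, ¬ NClq G v (ℓ - 1) D) : False := by
  have hcard := trv_card G σ P v (hP v) S hS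
  have hL2 := fun C D hC hD y hy hy' => nclq_eq G ℓ hℓ hno v C D hC hD y hy hy'
  obtain ⟨w1, hw1, w2, hw2, hw12⟩ := Finset.one_lt_card.1 (show 1 < C.card by rw [hC.1.1]; omega)
  obtain ⟨u1, C1, hne1, hσ1, hv1, hC1, hu1, hm1⟩ :=
    lonely_twin G ℓ hℓ hno σ P v hbad htw S C hS hCS hC hl w1 hw1
  obtain ⟨u2, C2, hne2, hσ2, hv2, hC2, hu2, hm2⟩ :=
    lonely_twin G ℓ hℓ hno σ P v hbad htw S C hS hCS hC hl w2 hw2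
  have hinj := hS.2.1
  have hu12 : u1 ≠ u2 := by
    rintro rfl
    exact hw12 (hinj _ (hCS hw1) _ (hCS hw2) (by rw [← hσ1, hσ2]))
  have hC12 : C1 ≠ C2 := by
    rintro rfl
    have := hm1 u2 hu2 hu12.symm
    have e := hinj _ this.1 _ (hCS hw2) hσ2
    exact hne2 e
  have hdisj : ∀ x ∈ C1, x ∉ C2 := fun x h1 h2 => hC12 (hL2 C1 C2 hC1 hC2 x h1 h2)
  have hsub : (C1.erase u1) ∪ (C2.erase u2) ⊆ S \ C := by
    intro x hx
    simp only [Finset.mem_union, Finset.mem_erase] at hx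
    rw [Finset.mem_sdiff]
    rcases hx with hx | hx
    · exact hm1 x hx.2 hx.1
    · exact hm2 x hx.2 hx.1
  have hcu : ((C1.erase u1) ∪ (C2.erase u2)).card = (ℓ - 2) + (ℓ - 2) := by
    rw [Finset.card_union_of_disjoint, Finset.card_erase_of_mem hu1, Finset.card_erase_of_mem hu2,
      hC1.1.1, hC2.1.1]
    · omega
    · rw [Finset.disjoint_left]
      intro x hx hx'
      exact hdisj x (Finset.mem_of_mem_erase hx) (Finset.mem_of_mem_erase hx')
  have hsc : (S \ C).card = t := by
    rw [Finset.card_sdiff_of_subset hCS, hC.1.1]; omega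
  have hle := Finset.card_le_card hsub
  rw [hcu, hsc] at hle
  have hl3 : ℓ = 3 := by omega
  have heq : (C1.erase u1) ∪ (C2.erase u2) = S \ C :=
    Finset.eq_of_subset_of_card_le hsub (by rw [hcu, hsc]; omega)
  have hSmem : ∀ x ∈ S, x ∉ C → x ∉ C1 → x ∈ C2 := by
    intro x hx hxC hx1
    have : x ∈ S \ C := Finset.mem_sdiff.2 ⟨hx, hxC⟩
    rw [← heq, Finset.mem_union] at this
    rcases this with h | h
    · exact absurd (Finset.mem_of_mem_erase h) hx1
    · exact Finset.mem_of_mem_erase h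
  have hS' := trv_swap G σ P v S hS w1 u1 (hCS hw1) hv1 hσ1
  have hS'm : ∀ x ∈ insert u1 (S.erase w1), x ∉ C1 → x ∈ S ∧ x ≠ w1 := by
    intro x hx hx1
    simp only [Finset.mem_insert, Finset.mem_erase] at hx
    rcases hx with rfl | hx
    · exact absurd hu1 hx1
    · exact ⟨hx.2, hx.1⟩
  have hw1C1 : w1 ∉ C1 := fun h => (hm1 w1 h hne1.symm).2 hw1
  have hC1S' : C1 ⊆ insert u1 (S.erase w1) := by
    intro x hx
    simp only [Finset.mem_insert, Finset.mem_erase]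
    by_cases h : x = u1
    · exact Or.inl h
    · exact Or.inr ⟨fun e => hw1C1 (e ▸ hx), (hm1 x hx h).1⟩
  have hu2S : u2 ∉ S := fun h => hne2 (hinj _ h _ (hCS hw2) hσ2)
  have hl' : ∀ D ⊆ insert u1 (S.erase w1) \ C1, ¬ NClq G v (ℓ - 1) D := by
    intro D hDS hD
    have hDm : ∀ x ∈ D, x ∈ S ∧ x ≠ w1 ∧ x ∉ C1 := by
      intro x hx
      have h := Finset.mem_sdiff.1 (hDS hx)
      have := hS'm x h.1 h.2
      exact ⟨this.1, this.2, h.2⟩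
    obtain ⟨x, hx⟩ := Finset.card_pos.1 (show 0 < D.card by rw [hD.1.1]; omega)
    by_cases hxC : x ∈ C
    · have := hL2 D C hD hC x hx hxC
      exact (hDm w1 (this ▸ hw1)).2.1 rfl
    · have := hL2 D C2 hD hC2 x hx (hSmem x (hDm x hx).1 hxC (hDm x hx).2.2)
      exact hu2S (hDm u2 (this ▸ hu2)).1
  obtain ⟨a, ha, hau⟩ := Finset.exists_mem_ne (show 1 < C1.card by rw [hC1.1.1]; omega) u1
  obtain ⟨haS, haC⟩ := hm1 a ha hau
  obtain ⟨u3, C3, hne3, hσ3, hv3, hC3, hu3, hm3⟩ :=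
    lonely_twin G ℓ hℓ hno σ P v hbad htw _ C1 hS' hC1S' hC1 hl' a ha
  obtain ⟨z, hz, hzu⟩ := Finset.exists_mem_ne (show 1 < C3.card by rw [hC3.1.1]; omega) u3
  obtain ⟨hzS', hz1⟩ := hm3 z hz hzu
  obtain ⟨hzS, hzw⟩ := hS'm z hzS' hz1
  have hu3S : u3 ∉ S := fun h => hne3 (hinj _ h _ haS hσ3)
  by_cases hzC : z ∈ C
  · have := hL2 C3 C hC3 hC z hz hzC
    exact hu3S (hCS (this ▸ hu3))
  · have := hL2 C3 C2 hC3 hC2 z hz (hSmem z hzS hzC hz1)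
    have h3 : u3 ∈ C2 := this ▸ hu3
    by_cases h : u3 = u2
    · subst h
      have : a = w2 := hinj _ haS _ (hCS hw2) (by rw [← hσ3, hσ2])
      exact haC (this ▸ hw2)
    · exact hu3S (hm2 u3 h3 h).1

open Classical in
lemma case_two (ℓ t : ℕ) (hℓ : 3 ≤ ℓ) (ht : 3 * t ≤ 2 * ℓ + 1) (hno : ¬ Cyc G (ℓ + 1)) (σ : V → ℕ)
    (P : Finset ℕ) (v : V) (hP : ∀ v, σ v ∈ P) (hPc : P.card = ℓ + t)
    (hbad : ∀ X : Finset V, (∀ d ∈ P, ∃ x ∈ X, σ x = d) → ¬ ColS G X (ℓ - 1))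
    (htw : ∀ C, NClq G v (ℓ - 1) C → ∀ w ∈ C, ∃ u, u ≠ w ∧ σ u = σ w)
    (hall : ∀ S C, Trv G σ P v S → C ⊆ S → NClq G v (ℓ - 1) C →
      ∃ D ⊆ S \ C, NClq G v (ℓ - 1) D)
    (S C : Finset V) (hS : Trv G σ P v S) (hCS : C ⊆ S) (hC : NClq G v (ℓ - 1) C) : False := by
  have hcard := trv_card G σ P v (hP v) S hS
  have hL2 := fun C D hC hD y hy hy' => nclq_eq G ℓ hℓ hno v C D hC hD y hy hy'
  have hinj := hS.2.1
  obtain ⟨D, hD', hD⟩ := hall S C hS hCS hC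
  have hsc : (S \ C).card = t := by
    rw [Finset.card_sdiff_of_subset hCS, hC.1.1]; omega
  have hle := Finset.card_le_card hD'
  rw [hsc, hD.1.1] at hle
  have hDe : D = S \ C := Finset.eq_of_subset_of_card_le hD' (by rw [hsc, hD.1.1]; omega)
  have hDS : D ⊆ S := fun x hx => (Finset.mem_sdiff.1 (hD' hx)).1
  have hDC : ∀ x ∈ D, x ∉ C := fun x hx => (Finset.mem_sdiff.1 (hD' hx)).2
  have hcov : ∀ x ∈ S, x ∈ C ∨ x ∈ D := by
    intro x hx
    rw [hDe, Finset.mem_sdiff]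
    tauto
  have hout : ∀ C D : Finset V, C ⊆ S → D ⊆ S → NClq G v (ℓ - 1) C → NClq G v (ℓ - 1) D →
      (∀ x ∈ D, x ∉ C) → (∀ x ∈ S, x ∈ C ∨ x ∈ D) → ∀ w ∈ C, ∀ u, u ≠ w → σ u = σ w →
      ¬ G.Adj v u := by
    intro C D hCS hDS hC hD hDC hcov w hw u huw hσu hvu
    have hwD : w ∉ D := fun h => hDC w h hw
    obtain ⟨D', hD'S, hD'⟩ := hall _ D (trv_swap G σ P v S hS w u (hCS hw) hvu hσu) (by
      intro x hx
      simp only [Finset.mem_insert, Finset.mem_erase]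
      exact Or.inr ⟨fun e => hwD (e ▸ hx), hDS hx⟩) hD
    have hm : ∀ x ∈ D', x ≠ u → x ∈ C ∧ x ≠ w := by
      intro x hx hxu
      have := hD'S hx
      simp only [Finset.mem_sdiff, Finset.mem_insert, Finset.mem_erase] at this
      obtain ⟨h | h, h2⟩ := this
      · exact absurd h hxu
      · exact ⟨(hcov x h.2).resolve_right h2, h.1⟩
    obtain ⟨x, hx, hxu⟩ := Finset.exists_mem_ne (show 1 < D'.card by rw [hD'.1.1]; omega) u
    have := hL2 D' C hD' hC x hx (hm x hx hxu).1
    exact (hm w (this ▸ hw) huw.symm).2 rfl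
  have htwS : ∀ x ∈ S, ∃ u, u ≠ x ∧ σ u = σ x ∧ ¬ G.Adj v u := by
    intro x hx
    rcases hcov x hx with h | h
    · obtain ⟨u, h1, h2⟩ := htw C hC x h
      exact ⟨u, h1, h2, hout C D hCS hDS hC hD hDC hcov x h u h1 h2⟩
    · obtain ⟨u, h1, h2⟩ := htw D hD x h
      exact ⟨u, h1, h2, hout D C hDS hCS hD hC (fun y h1 h2 => hDC y h2 h1)
        (fun y hy => (hcov y hy).symm) x h u h1 h2⟩
  haveI : Nonempty V := ⟨v⟩
  choose! tw htw1 htw2 htw3 using htwS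
  have htwi : ∀ x ∈ S, ∀ y ∈ S, x ≠ y → tw x ≠ tw y := by
    intro x hx y hy hxy e
    exact hxy (hinj x hx y hy (by rw [← htw2 x hx, ← htw2 y hy, e]))
  have hadj : ∀ w ∈ C, ∀ a ∈ D, G.Adj (tw w) (tw a) := by
    intro w hw a ha
    by_contra hn
    have hn' : ¬ G.Adj (tw a) (tw w) := fun h => hn h.symm
    obtain ⟨E, hES, hE⟩ := fgen G ℓ hℓ hno σ P v hbad S {w, a} {tw w, tw a} hS
      (by
        intro x hx
        simp only [Finset.mem_insert, Finset.mem_singleton] at hx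
        rcases hx with rfl | rfl
        · exact ⟨_, by simp, htw2 _ (hCS hw)⟩
        · exact ⟨_, by simp, htw2 _ (hDS ha)⟩)
      (by
        intro x hx
        simp only [Finset.mem_insert, Finset.mem_singleton] at hx
        rcases hx with rfl | rfl
        · exact htw3 _ (hCS hw)
        · exact htw3 _ (hDS ha))
      (by
        intro x hx y hy
        simp only [Finset.mem_insert, Finset.mem_singleton] at hx hy
        rcases hx with rfl | rfl <;> rcases hy with rfl | rfl <;>
          first | exact hn | exact hn' | exact G.irrefl)
    obtain ⟨x, hx⟩ := Finset.card_pos.1 (show 0 < E.card by rw [hE.1.1]; omega)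
    have hm : ∀ y ∈ E, y ∈ S ∧ y ≠ w ∧ y ≠ a := by
      intro y hy
      simpa using hES hy
    rcases hcov x (hm x hx).1 with h | h
    · have := hL2 E C hE hC x hx h
      exact (hm w (this ▸ hw)).2.1 rfl
    · have := hL2 E D hE hD x hx h
      exact (hm a (this ▸ ha)).2.2 rfl
  have hCD : ∀ w ∈ C, ∀ a ∈ D, w ≠ a := fun w hw a ha e => hDC a ha (e ▸ hw)
  rcases (show ℓ = 3 ∨ ℓ = 4 by omega) with rfl | rfl
  · obtain ⟨w1, hw1, w2, hw2, hw12⟩ := Finset.one_lt_card.1 (show 1 < C.card by rw [hC.1.1]; omega)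
    obtain ⟨a1, ha1, a2, ha2, ha12⟩ := Finset.one_lt_card.1 (show 1 < D.card by rw [hD.1.1]; omega)
    exact hno (cyc4 G (tw w1) (tw a1) (tw w2) (tw a2) (hadj _ hw1 _ ha1) (hadj _ hw2 _ ha1).symm
      (hadj _ hw2 _ ha2) (hadj _ hw1 _ ha2).symm (htwi _ (hCS hw1) _ (hCS hw2) hw12)
      (htwi _ (hDS ha1) _ (hDS ha2) ha12))
  · have hind : ∀ C D : Finset V, C ⊆ S → D ⊆ S → C.card = 3 → D.card = 3 →
        (∀ w ∈ C, ∀ a ∈ D, w ≠ a) → (∀ w ∈ C, ∀ a ∈ D, G.Adj (tw w) (tw a)) →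
        ∀ w ∈ C, ∀ w' ∈ C, ¬ G.Adj (tw w) (tw w') := by
      intro C D hCS hDS hC hD hCD hadj w hw w' hw' hww
      have hne : w ≠ w' := by rintro rfl; exact hww.ne rfl
      have : ∃ x ∈ C, x ≠ w ∧ x ≠ w' := by
        by_contra hcon
        push Not at hcon
        have hsub : C ⊆ {w, w'} := by
          intro x hx
          simp only [Finset.mem_insert, Finset.mem_singleton]
          by_cases h : x = w
          · exact Or.inl h
          · exact Or.inr (hcon x hx h)
        have := Finset.card_le_card hsub
        have := Finset.card_le_two (a := w) (b := w')
        omega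
      obtain ⟨x, hx, hxw, hxw'⟩ := this
      obtain ⟨a1, ha1, a2, ha2, ha12⟩ := Finset.one_lt_card.1 (show 1 < D.card by rw [hD]; omega)
      exact hno (cyc5 G (tw w) (tw w') (tw a1) (tw x) (tw a2) hww (hadj _ hw' _ ha1)
        (hadj _ hx _ ha1).symm (hadj _ hx _ ha2) (hadj _ hw _ ha2).symm
        (hadj _ hw _ ha1).ne (htwi _ (hCS hw) _ (hCS hx) hxw.symm)
        (htwi _ (hCS hw') _ (hCS hx) hxw'.symm) (hadj _ hw' _ ha2).ne
        (htwi _ (hDS ha1) _ (hDS ha2) ha12))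
    have hiC := hind C D hCS hDS hC.1.1 hD.1.1 hCD hadj
    have hiD := hind D C hDS hCS hD.1.1 hC.1.1 (fun w hw a ha => (hCD a ha w hw).symm)
      (fun w hw a ha => (hadj a ha w hw).symm)
    refine hbad (insert v (S.image tw)) ?_ ⟨fun x => if x ∈ D.image tw then 1 else 0, ?_, ?_⟩
    · intro d hd
      by_cases hdv : d = σ v
      · exact ⟨v, by simp, hdv.symm⟩
      · obtain ⟨x, hx, hxd⟩ := (hS.2.2 d).2 ⟨hd, hdv⟩
        exact ⟨tw x, Finset.mem_insert_of_mem (Finset.mem_image_of_mem _ hx),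
          (htw2 x hx).trans hxd⟩
    · intro x hx
      dsimp only
      split_ifs <;> omega
    · have hcl : ∀ x ∈ insert v (S.image tw), x ∉ D.image tw → x = v ∨ ∃ w ∈ C, tw w = x := by
        intro x hx hxD
        rw [Finset.mem_insert, Finset.mem_image] at hx
        rcases hx with h | ⟨w, hw, rfl⟩
        · exact Or.inl h
        · rcases hcov w hw with h | h
          · exact Or.inr ⟨w, h, rfl⟩
          · exact absurd (Finset.mem_image_of_mem _ h) hxD
      intro x hx y hy hxy
      dsimp only
      split_ifs with h1 h2 h2
      · rw [Finset.mem_image] at h1 h2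
        obtain ⟨a, ha, rfl⟩ := h1
        obtain ⟨b, hb, rfl⟩ := h2
        exact absurd hxy (hiD a ha b hb)
      · omega
      · omega
      · exfalso
        rcases hcl x hx h1 with rfl | ⟨w, hw, rfl⟩
        · rcases hcl y hy h2 with rfl | ⟨w', hw', rfl⟩
          · exact hxy.ne rfl
          · exact htw3 _ (hCS hw') hxy
        · rcases hcl y hy h2 with rfl | ⟨w', hw', rfl⟩
          · exact htw3 _ (hCS hw) hxy.symm
          · exact hiC w hw w' hw' hxy

lemma hard_case (ℓ t : ℕ) (hℓ : 3 ≤ ℓ) (ht1 : 1 ≤ t) (ht : 3 * t ≤ 2 * ℓ + 1)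
    (hno : ¬ Cyc G (ℓ + 1)) (σ : V → ℕ) (hσ : IsProperColoring G σ)
    (P : Finset ℕ) (hP : ∀ v, σ v ∈ P) (hPc : P.card = ℓ + t)
    (hcol : ¬ ColS G Finset.univ (P.card - 1))
    (hbad : ∀ X : Finset V, (∀ d ∈ P, ∃ x ∈ X, σ x = d) → ¬ ColS G X (ℓ - 1)) : False := by
  classical
  obtain ⟨v, hv1, hv2⟩ := exists_good_vertex G ℓ hno σ hσ P hP hcol (by omega) (by omega)
  obtain ⟨S, hS⟩ := trv_exists G σ P v hP hσ hv1
  have htw : ∀ C, NClq G v (ℓ - 1) C → ∀ w ∈ C, ∃ u, u ≠ w ∧ σ u = σ w :=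
    fun C hC w hw => hv2 C hC.1 hC.2 w hw
  by_cases hall : ∀ S C, Trv G σ P v S → C ⊆ S → NClq G v (ℓ - 1) C →
      ∃ D ⊆ S \ C, NClq G v (ℓ - 1) D
  · obtain ⟨C, hCS, hC⟩ := fgen G ℓ hℓ hno σ P v hbad S ∅ ∅ hS (by simp) (by simp) (by simp)
    exact case_two G ℓ t hℓ ht hno σ P v hP hPc hbad htw hall S C hS (by simpa using hCS) hC
  · push Not at hall
    obtain ⟨S, C, hS, hCS, hC, hl⟩ := hall
    exact case_one G ℓ t hℓ ht hno σ P v hP hPc hbad htw S C hS hCS hC hl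

end

section
variable {V : Type*} [Fintype V] (G : SimpleGraph V)

lemma exists_rainbow (σ : V → ℕ) (Q : Finset ℕ) (hQ : ∀ d ∈ Q, ∃ x, σ x = d) :
    ∃ X : Finset V, X.card = Q.card ∧ ∀ d, (∃ x ∈ X, σ x = d) ↔ d ∈ Q := by
  classical
  choose g hg using hQ
  refine ⟨Q.attach.image (fun d => g d.1 d.2), ?_, ?_⟩
  · rw [Finset.card_image_of_injective, Finset.card_attach]
    intro a b hab
    dsimp only at hab
    apply Subtype.ext
    rw [← hg a.1 a.2, ← hg b.1 b.2, hab]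
  · intro d
    constructor
    · rintro ⟨x, hx, rfl⟩
      rw [Finset.mem_image] at hx
      obtain ⟨e, _, rfl⟩ := hx
      rw [hg]
      exact e.2
    · intro hd
      exact ⟨g d hd, Finset.mem_image.2 ⟨⟨d, hd⟩, Finset.mem_attach _ _, rfl⟩, hg d hd⟩

lemma good_set (ℓ : ℕ) (hℓ : 3 ≤ ℓ) (hno : ¬ Cyc G (ℓ + 1))
    (hK : ¬ Nonempty (G ≃g (⊤ : SimpleGraph (Fin ℓ))))
    (hchi : 3 * chromNum G < 5 * ℓ + 2) (σ : V → ℕ) (hσ : IsProperColoring G σ) :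
    ∃ (X : Finset V) (Q : Finset ℕ) (c : ℕ), ColS G X c ∧ (∀ d ∈ Q, ∃ x ∈ X, σ x = d) ∧
      chromNum G + 1 + c ≤ ℓ + Q.card := by
  classical
  set k := chromNum G with hk
  set P := Finset.univ.image σ with hPdef
  have hP : ∀ v, σ v ∈ P := fun v => Finset.mem_image_of_mem _ (Finset.mem_univ _)
  have hPs : ∀ d ∈ P, ∃ x, σ x = d := by
    intro d hd
    obtain ⟨x, _, h⟩ := Finset.mem_image.1 hd
    exact ⟨x, h⟩
  have hkp : k ≤ P.card := colS_univ G _ (colS_of_colors G σ hσ P hP)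
  by_cases h1 : k < ℓ
  · exact ⟨∅, ∅, 0, ⟨fun _ => 0, by simp, by simp⟩, by simp, by simp; omega⟩
  by_cases h2 : k + 1 ≤ P.card
  · obtain ⟨Q, hQP, hQ⟩ := Finset.exists_subset_card_eq h2
    obtain ⟨X, hX, hXQ⟩ := exists_rainbow σ Q (fun d hd => hPs d (hQP hd))
    refine ⟨X, Q, ℓ, ?_, fun d hd => (hXQ d).2 hd, by omega⟩
    by_contra hcol
    exact hno (dense_cyc G X (ℓ + 1) (by omega) (by omega) hcol)
  have hpk : P.card = k := by omega
  by_cases h3 : k = ℓ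
  · by_cases hcl : ∃ K, Clq G K ℓ
    · obtain ⟨K, hKc⟩ := hcl
      have hinj : ∀ x ∈ K, ∀ y ∈ K, σ x = σ y → x = y := by
        intro x hx y hy h
        by_contra hne
        exact hσ (hKc.2 x hx y hy hne) h
      have hKimg : K.image σ = P := by
        apply Finset.eq_of_subset_of_card_le
        · exact Finset.image_subset_image (Finset.subset_univ _)
        · rw [Finset.card_image_of_injOn (fun x hx y hy h => hinj x hx y hy h), hKc.1]
          omega
      have hex : ∃ x, x ∉ K := by
        by_contra hcon
        push Not at hcon
        have hKu : K = Finset.univ := Finset.eq_univ_iff_forall.2 hcon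
        refine hK ⟨⟨Fintype.equivFinOfCardEq (by rw [← hKc.1, hKu]; rfl), ?_⟩⟩
        intro a b
        simp only [SimpleGraph.top_adj, ne_eq, EmbeddingLike.apply_eq_iff_eq]
        constructor
        · intro h
          exact hKc.2 a (hcon a) b (hcon b) h
        · intro h
          exact h.ne
      obtain ⟨x, hx⟩ := hex
      have hxP : σ x ∈ K.image σ := by rw [hKimg]; exact hP x
      obtain ⟨w, hw, hwx⟩ := Finset.mem_image.1 hxP
      obtain ⟨y1, hy1, y2, hy2, hy12⟩ := Finset.one_lt_card.1
        (show 1 < (K.erase w).card by rw [Finset.card_erase_of_mem hw, hKc.1]; omega)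
      have hy : ∃ y ∈ K.erase w, ¬ G.Adj x y := by
        by_contra hcon
        push Not at hcon
        exact hno (clique_ext G K ℓ hKc x y1 y2 hx (Finset.mem_of_mem_erase hy1)
          (Finset.mem_of_mem_erase hy2) hy12 (hcon _ hy1) (hcon _ hy2))
      obtain ⟨y, hy, hxy⟩ := hy
      have hxe : x ∉ K.erase w := fun h => hx (Finset.mem_of_mem_erase h)
      have hcard : (insert x (K.erase w)).card = ℓ := by
        rw [Finset.card_insert_of_notMem hxe, Finset.card_erase_of_mem hw, hKc.1]; omega
      refine ⟨insert x (K.erase w), P, ℓ - 1, ?_, ?_, by omega⟩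
      · rw [← hcard]
        exact colS_nonadj G _ x y (by simp) (Finset.mem_insert_of_mem hy)
          (fun e => hxe (e ▸ hy)) hxy
      · intro d hd
        rw [← hKimg] at hd
        obtain ⟨z, hz, rfl⟩ := Finset.mem_image.1 hd
        by_cases hzw : z = w
        · exact ⟨x, by simp, by rw [hzw, hwx]⟩
        · exact ⟨z, Finset.mem_insert_of_mem (Finset.mem_erase.2 ⟨hzw, hz⟩), rfl⟩
    · obtain ⟨X, hX, hXP⟩ := exists_rainbow σ P hPs
      have : ∃ a ∈ X, ∃ b ∈ X, a ≠ b ∧ ¬ G.Adj a b := by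
        by_contra hcon
        push Not at hcon
        exact hcl ⟨X, by omega, hcon⟩
      obtain ⟨a, ha, b, hb, hab, hn⟩ := this
      exact ⟨X, P, X.card - 1, colS_nonadj G X a b ha hb hab hn, fun d hd => (hXP d).2 hd,
        by omega⟩
  · by_contra hcon
    push Not at hcon
    refine hard_case G ℓ (k - ℓ) hℓ (by omega) (by omega) hno σ hσ P hP (by omega) ?_ ?_
    · intro h
      have := colS_univ G _ h
      omega
    · intro X hX hcol
      have := hcon X P (ℓ - 1) hcol hX
      omega

end


/-- For every integer `ℓ ≥ 3`, every finite `C_{ℓ+1}`-free simple graph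
`G` with at least one vertex, not isomorphic to `K_ℓ`, with `χ(G) < (5ℓ+2)/3`,
satisfies `φ(G) ≥ χ(G) - ℓ + 1`. -/
theorem cycleFree_chromDisc_smallChi {V : Type*} [Fintype V] [Nonempty V]
    (ℓ : ℕ) (hℓ : 3 ≤ ℓ) (G : SimpleGraph V) (hc : CycleLenFree G (ℓ + 1))
    (hK : ¬ Nonempty (G ≃g (⊤ : SimpleGraph (Fin ℓ))))
    (hchi : (chromNum G : ℝ) < (5 * ℓ + 2) / 3) :
    chromDisc G ≥ (chromNum G : ℤ) - ℓ + 1 := by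
  have hno : ¬ Cyc G (ℓ + 1) := cyc_false G (ℓ + 1) (by omega) hc
  have hchi' : 3 * chromNum G < 5 * ℓ + 2 := by
    have : (3 : ℝ) * chromNum G < 5 * ℓ + 2 := by linarith
    exact_mod_cast this
  refine le_csInf ?_ ?_
  · obtain ⟨c, _, hci⟩ := exists_code (Finset.univ : Finset V)
    exact ⟨_, c, fun u v huv h => huv.ne (hci (by simp) (by simp) h), rfl⟩
  · rintro z ⟨σ, hσ, rfl⟩
    obtain ⟨X, Q, c, hX, hQ, hle⟩ := good_set G ℓ hℓ hno hK hchi' σ hσ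
    have hcol := colS_iff G X c hX
    have hcard : Q.card ≤ (σ '' (X : Set V)).ncard := by
      rw [← Set.ncard_coe_finset]
      refine Set.ncard_le_ncard ?_ (Set.toFinite _)
      intro d hd
      obtain ⟨x, hx, hxd⟩ := hQ d hd
      exact ⟨x, hx, hxd⟩
    have hb : (((σ '' (X : Set V)).ncard : ℤ) - (chromNum (G.induce (X : Set V)) : ℤ)) ≤
        colDisc G σ := by
      refine le_csSup ?_ ⟨X, rfl⟩
      refine ⟨(Fintype.card V : ℤ), ?_⟩
      rintro z ⟨S, rfl⟩
      have h1 : (σ '' S).ncard ≤ S.ncard := Set.ncard_image_le (Set.toFinite _)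
      have h2 : S.ncard ≤ Fintype.card V := by
        rw [← Nat.card_eq_fintype_card, ← Set.ncard_univ]
        exact Set.ncard_le_ncard (Set.subset_univ _) (Set.toFinite _)
      omega
    omega
end

section
/- For every integer s ≥ 1, every finite locally s-colourable simple graph G on n vertices satisfies χ(G) ≤ max { s, ⌊3n/5⌋ }. -/
open SimpleGraph

namespace LocCol

open Classical

/-- Proper colouring with `k` colours. -/
def PC {V : Type*} {α : Type*} (G : SimpleGraph V) (c : V → α) : Prop :=
  ∀ u v, G.Adj u v → c u ≠ c v

/-- `v` is alone in its colour class. -/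
def Sg {V : Type*} {α : Type*} (c : V → α) (v : V) : Prop := ∀ u, c u = c v → u = v

noncomputable def singles {V : Type*} [Fintype V] {α : Type*} (c : V → α) : Finset V :=
  Finset.univ.filter (Sg c)

theorem mem_singles {V : Type*} [Fintype V] {α : Type*} (c : V → α) (v : V) :
    v ∈ singles c ↔ Sg c v := by simp [singles]

/-- A proper colouring with the fewest singleton classes. -/
def MinS {V : Type*} [Fintype V] {k : ℕ} (G : SimpleGraph V) (c : V → Fin k) : Prop :=
  PC G c ∧ ∀ c' : V → Fin k, PC G c' → (singles c).card ≤ (singles c').card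

theorem colorable_of_image {V : Type*} {α : Type*} (G : SimpleGraph V) (c : V → α)
    (hc : PC G c) (S : Finset α) (hS : ∀ v, c v ∈ S) (K : ℕ) (hK : S.card ≤ K) :
    G.Colorable K := by
  let C : G.Coloring S := SimpleGraph.Coloring.mk (fun v => ⟨c v, hS v⟩) (by
    intro u v h e
    exact hc u v h (by simpa using e))
  have := C.colorable
  rw [Fintype.card_coe] at this
  exact this.mono hK

/-- Merging a singleton into another class. -/
theorem merge {V : Type*} {K : ℕ} (G : SimpleGraph V) (hG : ¬ G.Colorable K)
    (c : V → Fin (K+1)) (hc : PC G c) (z : V) (hz : Sg c z) (b : Fin (K+1)) (hb : b ≠ c z)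
    (h : ∀ u, c u = b → ¬ G.Adj z u) : False := by
  apply hG
  refine colorable_of_image G (Function.update c z b) ?_ (Finset.univ.erase (c z)) ?_ K (by simp)
  · intro u v huv
    by_cases hu : u = z
    · subst hu
      have : v ≠ u := huv.ne'
      simp only [Function.update_self, Function.update_of_ne this]
      intro e
      exact h v e.symm huv
    · by_cases hv : v = z
      · subst hv
        simp only [Function.update_self, Function.update_of_ne hu]
        intro e
        exact h u e huv.symm
      · simp only [Function.update_of_ne hu, Function.update_of_ne hv]
        exact hc u v huv
  · intro v
    by_cases hv : v = z
    · subst hv; simpa using hb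
    · simp only [Function.update_of_ne hv, Finset.mem_erase, Finset.mem_univ, and_true]
      exact fun e => hv (hz v e)

theorem merge2 {V : Type*} {K : ℕ} (G : SimpleGraph V) (hG : ¬ G.Colorable K)
    (c : V → Fin (K+1)) (hc : PC G c) (z y : V) (hz : Sg c z) (hy : Sg c y) (hne : z ≠ y)
    (h : ¬ G.Adj z y) : False := by
  refine merge G hG c hc z hz (c y) (fun e => hne (hz y e).symm) ?_
  intro u hu
  rw [hy u hu]; exact h

/-- A system of common representatives for two colourings. -/
theorem hall {V : Type*} [Fintype V] {K : ℕ} (G : SimpleGraph V) (hG : ¬ G.Colorable K)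
    (c d : V → Fin (K+1)) (hc : PC G c) (hd : PC G d) :
    ∃ f : Fin (K+1) → Fin (K+1), Function.Bijective f ∧ ∀ a, ∃ v, c v = a ∧ d v = f a := by
  have key := (Finset.all_card_le_biUnion_card_iff_exists_injective
    (fun a : Fin (K+1) => (Finset.univ.filter (fun v => c v = a)).image d)).1 (by
      intro A
      by_contra hlt
      push Not at hlt
      apply hG
      set N := A.biUnion (fun a : Fin (K+1) => (Finset.univ.filter (fun v => c v = a)).image d)
        with hN
      refine colorable_of_image G
        (fun v => if c v ∈ A then (Sum.inl (d v) : Fin (K+1) ⊕ Fin (K+1)) else Sum.inr (c v))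
        ?_ (N.disjSum Aᶜ) ?_ K ?_
      · intro u v huv
        have h1 := hc u v huv
        have h2 := hd u v huv
        by_cases hu : c u ∈ A <;> by_cases hv : c v ∈ A <;> simp [hu, hv, h1, h2]
      · intro v
        by_cases hv : c v ∈ A
        · simp only [hv, if_true, Finset.inl_mem_disjSum, hN, Finset.mem_biUnion]
          exact ⟨c v, hv, by simp only [Finset.mem_image, Finset.mem_filter]; exact ⟨v, by simp, rfl⟩⟩
        · simp [hv]
      · rw [Finset.card_disjSum, Finset.card_compl, Fintype.card_fin]
        have : A.card ≤ K + 1 := by simpa using Finset.card_le_univ A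
        omega)
  obtain ⟨f, hf, hf2⟩ := key
  refine ⟨f, Finite.injective_iff_bijective.1 hf, fun a => ?_⟩
  have := hf2 a
  simp only [Finset.mem_image, Finset.mem_filter, Finset.mem_univ, true_and] at this
  exact this

/-- Shifting along a path. -/
theorem shift {V : Type*} [Fintype V] {k : ℕ} (G : SimpleGraph V)
    (d : V → Fin k) (hd : PC G d) (t : Fin k → V) (hdt : ∀ a, d (t a) = a) (p : ℕ → Fin k)
    (r : ℕ) : ∀ (c : V → Fin k), MinS G c → (∀ a, c (t a) = a) →
      (∀ i j, i ≤ r → j ≤ r → p i = p j → i = j) →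
      (∀ i, i < r → ∃ v, c v = p i ∧ d v = p (i+1)) → Sg c (t (p r)) →
      ∃ c' : V → Fin k, MinS G c' ∧ Sg c' (t (p 0)) ∧
        ∀ x, Sg c x → x ≠ t (p r) → Sg c' x := by
  induction r with
  | zero =>
    intro c hc hct hp hv hz
    exact ⟨c, hc, hz, fun x hx _ => hx⟩
  | succ r ih =>
    intro c hc hct hp hv hz
    obtain ⟨v, hv1, hv2⟩ := hv r (by omega)
    have hab : p r ≠ p (r+1) := fun e => by
      have := hp r (r+1) (by omega) (by omega) e
      omega
    set a := p r with ha
    set b := p (r+1) with hb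
    have hvz : v ≠ t b := fun e => hab (by rw [← hv1, e, hct])
    have hva : v ≠ t a := fun e => hab (by rw [← hv2, e, hdt])
    have hnadj : ¬ G.Adj v (t b) := fun h => hd _ _ h (by rw [hv2, hdt])
    have hbz : ∀ u, c u = b → u = t b := fun u hu => hz u (by rw [hu, hct])
    set c1 := Function.update c v b with hc1
    have c1v : c1 v = b := by simp [hc1]
    have c1u : ∀ u, u ≠ v → c1 u = c u := fun u hu => by simp [hc1, hu]
    have hpc1 : PC G c1 := by
      intro u w huw e
      by_cases hu : u = v
      · subst hu
        have hw := huw.ne'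
        rw [c1v, c1u w hw] at e
        rw [hbz w e.symm] at huw
        exact hnadj huw
      · by_cases hw : w = v
        · subst hw
          rw [c1v, c1u u hu] at e
          rw [hbz u e] at huw
          exact hnadj huw.symm
        · rw [c1u u hu, c1u w hw] at e
          exact hc.1 u w huw e
    have hct1 : ∀ a, c1 (t a) = a := by
      intro a'
      by_cases h : t a' = v
      · exfalso
        have h1 : a' = a := by rw [← hct a', h, hv1]
        exact hva (by rw [← h, h1])
      · rw [c1u _ h, hct]
    have hvns : ¬ Sg c v := fun h => hva (h (t a) (by rw [hct, hv1])).symm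
    have hans : ¬ Sg c (t a) := fun h => hva (h v (by rw [hct, hv1]))
    -- singles of c other than `t b` remain
    have hkeep : ∀ x, Sg c x → x ≠ t b → Sg c1 x := by
      intro x hx hxb u hu
      have hxv : x ≠ v := fun e => hvns (e ▸ hx)
      rw [c1u x hxv] at hu
      by_cases huv : u = v
      · subst huv
        rw [c1v] at hu
        exact absurd (hbz x hu.symm) hxb
      · rw [c1u u huv] at hu
        exact hx u hu
    have hbn1 : ¬ Sg c1 (t b) := fun h => hvz (h v (by rw [c1v, hct1]))
    have hvn1 : ¬ Sg c1 v := fun h => hvz (h (t b) (by rw [c1v, hct1])).symm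
    have hback : ∀ x, Sg c1 x → x ≠ t a → Sg c x := by
      intro x hx hxa u hu
      have hxv : x ≠ v := fun e => hvn1 (e ▸ hx)
      by_cases huv : u = v
      · subst huv
        exfalso
        apply hxa
        have := hx (t a) (by rw [hct1, c1u x hxv, ← hu, hv1])
        exact this.symm
      · exact hx u (by rw [c1u u huv, c1u x hxv, hu])
    have hsa : Sg c1 (t a) := by
      by_contra hna
      have hsub : singles c1 ⊆ (singles c).erase (t b) := by
        intro x hx
        rw [mem_singles] at hx
        rw [Finset.mem_erase, mem_singles]
        exact ⟨fun e => hbn1 (e ▸ hx), hback x hx (fun e => hna (e ▸ hx))⟩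
      have h1 := Finset.card_le_card hsub
      have h2 := Finset.card_erase_lt_of_mem ((mem_singles c (t b)).2 hz)
      have h3 := hc.2 c1 hpc1
      omega
    have hmin1 : MinS G c1 := by
      refine ⟨hpc1, fun c' hc' => le_trans ?_ (hc.2 c' hc')⟩
      have hsub : singles c1 ⊆ insert (t a) ((singles c).erase (t b)) := by
        intro x hx
        rw [mem_singles] at hx
        rw [Finset.mem_insert, Finset.mem_erase, mem_singles]
        by_cases hxa : x = t a
        · exact Or.inl hxa
        · exact Or.inr ⟨fun e => hbn1 (e ▸ hx), hback x hx hxa⟩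
      have h1 := Finset.card_le_card hsub
      have h2 := Finset.card_erase_lt_of_mem ((mem_singles c (t b)).2 hz)
      have h3 := Finset.card_insert_le (t a) ((singles c).erase (t b))
      omega
    obtain ⟨c', h1, h2, h3⟩ := ih c1 hmin1 hct1
      (fun i j hi hj e => hp i j (by omega) (by omega) e) (by
        intro i hi
        obtain ⟨u, hu1, hu2⟩ := hv i (by omega)
        refine ⟨u, ?_, hu2⟩
        have : u ≠ v := by
          intro e
          have := hp i r (by omega) (by omega) (by rw [← hu1, e, hv1])
          omega
        rw [c1u u this, hu1]) hsa
    refine ⟨c', h1, h2, fun x hx hxb => h3 x (hkeep x hx hxb) ?_⟩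
    intro e
    exact hans (e ▸ hx)

/-- The move lemma. -/
theorem move {V : Type*} [Fintype V] {K : ℕ} (G : SimpleGraph V) (hG : ¬ G.Colorable K)
    (hcrit : ∀ y, ∃ d : V → Fin (K+1), PC G d ∧ Sg d y)
    (c : V → Fin (K+1)) (hc : MinS G c) (z y : V) (hz : Sg c z) (hzy : z ≠ y)
    (hadj : ¬ G.Adj z y) :
    ∃ c' : V → Fin (K+1), MinS G c' ∧ Sg c' y ∧ ∀ x, Sg c x → x ≠ z → Sg c' x := by
  obtain ⟨d0, hd0, hy0⟩ := hcrit y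
  obtain ⟨f, hf, hf2⟩ := hall G hG c d0 hc.1 hd0
  let e := Equiv.ofBijective f hf
  let d : V → Fin (K+1) := fun v => e.symm (d0 v)
  have hd : PC G d := fun u v huv h => hd0 u v huv (e.symm.injective h)
  have hy : Sg d y := fun u hu => hy0 u (e.symm.injective hu)
  have ht : ∀ a, ∃ v, c v = a ∧ d v = a := by
    intro a
    obtain ⟨v, h1, h2⟩ := hf2 a
    refine ⟨v, h1, ?_⟩
    change e.symm (d0 v) = a
    rw [h2, Equiv.symm_apply_eq]; rfl
  choose t hct hdt using ht
  have hty : t (d y) = y := hy _ (hdt _)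
  have hcy : c y = d y := by
    have := hct (d y)
    rwa [hty] at this
  have htz : t (c z) = z := hz _ (hct _)
  let A : Set (Fin (K+1)) := {b | ∃ (r : ℕ) (p : ℕ → Fin (K+1)), p 0 = d y ∧ p r = b ∧
    (∀ i j, i ≤ r → j ≤ r → p i = p j → i = j) ∧
    (∀ i, i < r → ∃ v, c v = p i ∧ d v = p (i+1))}
  have hA0 : d y ∈ A := ⟨0, fun _ => d y, rfl, rfl, fun i j hi hj _ => by omega,
    fun i hi => by omega⟩
  have hAcl : ∀ v, c v ∈ A → d v ∈ A := by
    rintro v ⟨r, p, hp0, hpr, hinj, hs⟩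
    by_cases hex : ∃ i, i ≤ r ∧ p i = d v
    · obtain ⟨i, hi, hpi⟩ := hex
      exact ⟨i, p, hp0, hpi, fun a b ha hb => hinj a b (by omega) (by omega),
        fun j hj => hs j (by omega)⟩
    · push Not at hex
      refine ⟨r+1, Function.update p (r+1) (d v), ?_, by simp, ?_, ?_⟩
      · rw [Function.update_of_ne (by omega), hp0]
      · intro i j hi hj hij
        by_cases h1 : i = r+1 <;> by_cases h2 : j = r+1
        · omega
        · rw [h1, Function.update_self, Function.update_of_ne h2] at hij
          exact absurd hij.symm (hex j (by omega))
        · rw [h2, Function.update_self, Function.update_of_ne h1] at hij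
          exact absurd hij (hex i (by omega))
        · rw [Function.update_of_ne h1, Function.update_of_ne h2] at hij
          exact hinj i j (by omega) (by omega) hij
      · intro i hi
        rw [Function.update_of_ne (by omega : i ≠ r+1)]
        by_cases h : i = r
        · subst h
          exact ⟨v, hpr.symm, by simp⟩
        · rw [Function.update_of_ne (by omega : i+1 ≠ r+1)]
          exact hs i (by omega)
  by_cases hzA : c z ∈ A
  · obtain ⟨r, p, hp0, hpr, hinj, hs⟩ := hzA
    have := shift G d hd t hdt p r c hc hct hinj hs (by rw [hpr, htz]; exact hz)
    rw [hp0, hty, hpr, htz] at this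
    exact this
  · exfalso
    let g : V → Fin (K+1) := fun v => if c v ∈ A then d v else c v
    have gin : ∀ v, c v ∈ A → g v = d v := fun v hv => if_pos hv
    have gout : ∀ v, c v ∉ A → g v = c v := fun v hv => if_neg hv
    have hg : PC G g := by
      intro u v huv h
      by_cases hu : c u ∈ A <;> by_cases hv : c v ∈ A
      · rw [gin u hu, gin v hv] at h; exact hd u v huv h
      · rw [gin u hu, gout v hv] at h; exact hv (h ▸ hAcl u hu)
      · rw [gout u hu, gin v hv] at h; exact hu (h ▸ hAcl v hv)
      · rw [gout u hu, gout v hv] at h; exact hc.1 u v huv h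
    refine merge2 G hG g hg z y ?_ ?_ hzy hadj
    · intro u hu
      rw [gout z hzA] at hu
      by_cases h : c u ∈ A
      · rw [gin u h] at hu
        exact absurd (hu ▸ hAcl u h) hzA
      · rw [gout u h] at hu
        exact hz u hu
    · intro u hu
      rw [gin y (hcy ▸ hA0)] at hu
      by_cases h : c u ∈ A
      · rw [gin u h] at hu
        exact hy u hu
      · rw [gout u h] at hu
        exact absurd (hu ▸ hA0) h

/-- Distinct singletons lie in different components of the complement. -/
theorem not_reach {V : Type*} [Fintype V] {K : ℕ} (G : SimpleGraph V) (hG : ¬ G.Colorable K)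
    (hcrit : ∀ y, ∃ d : V → Fin (K+1), PC G d ∧ Sg d y) (x z : V) (h : Gᶜ.Reachable z x)
    (hne : z ≠ x) (c : V → Fin (K+1)) (hc : MinS G c) (hz : Sg c z) (hx : Sg c x) : False := by
  obtain ⟨w⟩ := h
  induction w generalizing c with
  | nil => exact hne rfl
  | @cons z y x' hzy w ih =>
    rw [SimpleGraph.compl_adj] at hzy
    by_cases hyx : y = x'
    · subst hyx
      exact merge2 G hG c hc.1 z y hz hx hne hzy.2
    · obtain ⟨c', h1, h2, h3⟩ := move G hG hcrit c hc z y hz hzy.1 hzy.2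
      exact ih hyx c' h1 h2 (h3 _ hx hne.symm)

/-- Two further classes in the component of a singleton. -/
theorem two_classes {V : Type*} [Fintype V] {K : ℕ} (G : SimpleGraph V) (hG : ¬ G.Colorable K)
    (hcrit : ∀ y, ∃ d : V → Fin (K+1), PC G d ∧ Sg d y)
    (hdom : ∀ v, ∃ u, u ≠ v ∧ ¬ G.Adj v u)
    (c : V → Fin (K+1)) (hc : MinS G c) (z : V) (hz : Sg c z) :
    ∃ y w, Gᶜ.Reachable z y ∧ Gᶜ.Reachable z w ∧ ¬ Sg c y ∧ ¬ Sg c w ∧ c y ≠ c w := by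
  obtain ⟨y, hyz, hadj⟩ := hdom z
  have hzy : Gᶜ.Adj z y := by rw [SimpleGraph.compl_adj]; exact ⟨hyz.symm, hadj⟩
  have hns : ∀ x, x ≠ z → Gᶜ.Reachable z x → ¬ Sg c x := fun x hx hr hs =>
    not_reach G hG hcrit x z hr hx.symm c hc hz hs
  have hysn := hns y hyz hzy.reachable
  obtain ⟨c', hc', hy', -⟩ := move G hG hcrit c hc z y hz hyz.symm hadj
  have hcyz : c y ≠ c z := fun e => hyz (hz y e)
  -- some `u` of colour `c y` adjacent to `z`
  have : ∃ u, c u = c y ∧ G.Adj z u := by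
    by_contra hno
    push Not at hno
    exact merge G hG c hc.1 z hz (c y) hcyz hno
  obtain ⟨u, hu, hzu⟩ := this
  have huy : u ≠ y := fun e => hadj (e ▸ hzu)
  have hyu : Gᶜ.Adj y u := by
    rw [SimpleGraph.compl_adj]
    exact ⟨huy.symm, fun h => hc.1 _ _ h hu.symm⟩
  have hu' : ¬ Sg c' u := fun h => not_reach G hG hcrit u y hyu.reachable huy.symm c' hc' hy' h
  unfold Sg at hu'
  push Not at hu'
  obtain ⟨w, hw, hwu⟩ := hu'
  have hwy : w ≠ y := fun e => huy (hy' u (by rw [← hw, e]))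
  have hwz : w ≠ z := fun e => hc'.1 z u hzu (by rw [← hw, e])
  have huw : Gᶜ.Adj u w := by
    rw [SimpleGraph.compl_adj]
    exact ⟨hwu.symm, fun h => hc'.1 _ _ h hw.symm⟩
  have hrw : Gᶜ.Reachable z w := hzy.reachable.trans (hyu.reachable.trans huw.reachable)
  refine ⟨y, w, hzy.reachable, hrw, hysn, hns w hwz hrw, ?_⟩
  intro hcyw
  have hzz : ∀ v, c v = c z → v = z := hz
  set c1 := Function.update c y (c z) with hc1
  have c1y : c1 y = c z := by simp [hc1]
  have c1u : ∀ v, v ≠ y → c1 v = c v := fun v hv => by simp [hc1, hv]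
  have hpc1 : PC G c1 := by
    intro a b hab e
    by_cases ha : a = y
    · subst ha
      rw [c1y, c1u b hab.ne'] at e
      rw [hz b e.symm] at hab
      exact hadj hab.symm
    · by_cases hb : b = y
      · subst hb
        rw [c1y, c1u a ha] at e
        rw [hz a e] at hab
        exact hadj hab
      · rw [c1u a ha, c1u b hb] at e
        exact hc.1 a b hab e
  have hsub : singles c1 ⊆ (singles c).erase z := by
    intro x hx
    rw [mem_singles] at hx
    rw [Finset.mem_erase, mem_singles]
    have hxz : x ≠ z := by
      rintro rfl
      exact hyz (hx y (by rw [c1y, c1u _ hyz.symm]))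
    have hxy : x ≠ y := by
      rintro rfl
      exact hyz (hx z (by rw [c1y, c1u _ hyz.symm])).symm
    refine ⟨hxz, fun v hv => ?_⟩
    by_cases hvy : v = y
    · subst hvy
      exfalso
      have h1 := hx u (by rw [c1u u huy, c1u x hxy, hu, hv])
      have h2 := hx w (by rw [c1u w hwy, c1u x hxy, ← hcyw, hv])
      exact hwu (h2.trans h1.symm)
    · exact hx v (by rw [c1u v hvy, c1u x hxy, hv])
  have h1 := Finset.card_le_card hsub
  have h2 := Finset.card_erase_lt_of_mem ((mem_singles c z).2 hz)
  have h3 := hc.2 c1 hpc1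
  omega

/-- Counting: a vertex-critical graph without dominating vertex has at least `5k/3` vertices. -/
theorem count {V : Type*} [Fintype V] {K : ℕ} (G : SimpleGraph V) (hG : ¬ G.Colorable K)
    (hcrit : ∀ y, ∃ d : V → Fin (K+1), PC G d ∧ Sg d y)
    (hdom : ∀ v, ∃ u, u ≠ v ∧ ¬ G.Adj v u) (hne : Nonempty V) :
    5 * (K + 1) ≤ 3 * Fintype.card V := by
  obtain ⟨c, hc⟩ : ∃ c : V → Fin (K+1), MinS G c := by
    obtain ⟨v⟩ := hne
    obtain ⟨d, hd, -⟩ := hcrit v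
    obtain ⟨c, hc, hm⟩ := Finset.exists_min_image
      (Finset.univ.filter (fun c : V → Fin (K+1) => PC G c)) (fun c => (singles c).card)
      ⟨d, by simpa using hd⟩
    refine ⟨c, by simpa using hc, fun c' hc' => hm c' (by simpa using hc')⟩
  have hsurj : Function.Surjective c := by
    intro b
    by_contra hb
    push Not at hb
    exact hG (colorable_of_image G c hc.1 (Finset.univ.erase b)
      (fun v => by simpa using hb v) K (by simp))
  choose y w hry hrw hny hnw hyw using
    fun z : singles c => two_classes G hG hcrit hdom c hc z.1 ((mem_singles c z.1).1 z.2)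
  -- the colours of singletons and the other colours
  set P := (singles c).image c with hP
  have hPcard : P.card = (singles c).card := Finset.card_image_of_injOn (by
    intro a ha b hb e
    exact ((mem_singles c b).1 hb) a e)
  have hmemP : ∀ v, c v ∈ P ↔ Sg c v := by
    intro v
    rw [hP, Finset.mem_image]
    constructor
    · rintro ⟨a, ha, e⟩
      have := (mem_singles c a).1 ha
      rw [this v e.symm]; exact this
    · intro h; exact ⟨v, (mem_singles c v).2 h, rfl⟩
  -- vertices of the same colour are in the same component
  have hreach : ∀ a b, c a = c b → Gᶜ.Reachable a b := by
    intro a b e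
    by_cases hab : a = b
    · rw [hab]
    · refine SimpleGraph.Adj.reachable ?_
      rw [SimpleGraph.compl_adj]
      exact ⟨hab, fun h => hc.1 _ _ h e⟩
  let F : singles c × Bool → (Pᶜ : Finset (Fin (K+1))) := fun q =>
    if q.2 then ⟨c (y q.1), by rw [Finset.mem_compl, hmemP]; exact hny _⟩
    else ⟨c (w q.1), by rw [Finset.mem_compl, hmemP]; exact hnw _⟩
  let m : singles c × Bool → V := fun q => if q.2 then y q.1 else w q.1
  have hFm : ∀ q, (F q : Fin (K+1)) = c (m q) := by
    rintro ⟨q, b⟩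
    cases b <;> simp [F, m]
  have hm : ∀ q, Gᶜ.Reachable q.1.1 (m q) := by
    rintro ⟨q, b⟩
    cases b
    · simpa [m] using hrw q
    · simpa [m] using hry q
  have hF : Function.Injective F := by
    intro q q' e
    have e' : c (m q) = c (m q') := by rw [← hFm, ← hFm, e]
    have hr : Gᶜ.Reachable q.1.1 q'.1.1 :=
      (hm q).trans ((hreach _ _ e').trans (hm q').symm)
    have h1 : q.1 = q'.1 := by
      by_contra hne'
      exact not_reach G hG hcrit q'.1.1 q.1.1 hr (fun h => hne' (Subtype.ext h)) c hc
        ((mem_singles c _).1 q.1.2) ((mem_singles c _).1 q'.1.2)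
    obtain ⟨q, b⟩ := q
    obtain ⟨q', b'⟩ := q'
    simp only at h1
    subst h1
    cases b <;> cases b'
    · rfl
    · exact absurd (by simpa [m] using e'.symm) (hyw q)
    · exact absurd (by simpa [m] using e') (hyw q)
    · rfl
  have h2 := Fintype.card_le_of_injective F hF
  rw [Fintype.card_prod, Fintype.card_bool, Fintype.card_coe, Fintype.card_coe,
    Finset.card_compl, Fintype.card_fin] at h2
  have hPle : P.card ≤ K + 1 := by simpa using Finset.card_le_univ P
  -- number of vertices
  have hV : Fintype.card V = ∑ b : Fin (K+1), (Finset.univ.filter (fun v => c v = b)).card := by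
    rw [← Finset.card_univ]
    exact Finset.card_eq_sum_card_fiberwise (fun _ _ => Finset.mem_univ _)
  have hsum : ∑ b : Fin (K+1), (if b ∈ P then 1 else 2) ≤ Fintype.card V := by
    rw [hV]
    refine Finset.sum_le_sum fun b _ => ?_
    obtain ⟨v, rfl⟩ := hsurj b
    split_ifs with hb
    · exact Finset.card_pos.2 ⟨v, by simp⟩
    · rw [hmemP] at hb
      unfold Sg at hb
      push Not at hb
      obtain ⟨u, hu, huv⟩ := hb
      exact Finset.one_lt_card.2 ⟨u, by simpa using hu, v, by simp, huv⟩
  have hsum2 : ∑ b : Fin (K+1), (if b ∈ P then 1 else 2) = P.card + 2 * Pᶜ.card := by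
    rw [← Finset.sum_add_sum_compl P,
      Finset.sum_congr rfl (fun b hb => if_pos hb),
      Finset.sum_congr (s₁ := Pᶜ) rfl (fun b hb => if_neg (Finset.mem_compl.1 hb))]
    simp [mul_comm]
  rw [hsum2, Finset.card_compl, Fintype.card_fin] at hsum
  omega

theorem main (K : ℕ) (n : ℕ) : ∀ {V : Type*} [Fintype V] (G : SimpleGraph V),
    Fintype.card V = n → ¬ G.Colorable K → 3 * n < 5 * (K + 1) →
    ∃ v, ¬ (G.induce (insert v (G.neighborSet v))).Colorable K := by
  induction n using Nat.strong_induction_on with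
  | _ n ih =>
  intro V _ G hn hG hlt
  by_cases hcr : ∃ v, ¬ (G.induce ({v}ᶜ : Set V)).Colorable K
  · obtain ⟨v, hv⟩ := hcr
    have hcard : Fintype.card ({v}ᶜ : Set V) < n := by
      rw [← hn]
      exact Fintype.card_subtype_lt (x := v) (by simp)
    obtain ⟨u, hu⟩ := ih _ hcard (G.induce ({v}ᶜ : Set V)) rfl hv (by omega)
    refine ⟨u.1, fun hcol => hu ?_⟩
    have hmem : ∀ x : (insert u ((G.induce ({v}ᶜ : Set V)).neighborSet u) : Set _),
        x.1.1 ∈ insert u.1 (G.neighborSet u.1) := by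
      intro x
      rcases x.2 with h | h
      · left; rw [h]
      · right; simpa using h
    obtain ⟨C⟩ := hcol
    exact ⟨SimpleGraph.Coloring.mk (fun x => C ⟨x.1.1, hmem x⟩)
      (fun {a b} hab => C.valid (by simpa using hab))⟩
  · push Not at hcr
    have hne : Nonempty V := by
      by_contra h
      rw [not_nonempty_iff] at h
      exact hG (SimpleGraph.Colorable.of_isEmpty _)
    by_cases hdom : ∀ v, ∃ u, u ≠ v ∧ ¬ G.Adj v u
    · exfalso
      have := count G hG (by
        intro y
        obtain ⟨C⟩ := hcr y
        refine ⟨fun v => if h : v = y then Fin.last K else (C ⟨v, by simpa using h⟩).castSucc,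
          ?_, ?_⟩
        · intro a b hab
          by_cases ha : a = y <;> by_cases hb : b = y
          · exact absurd (ha.trans hb.symm) hab.ne
          · simp [ha, hb, (Fin.castSucc_lt_last _).ne']
          · simp [ha, hb, (Fin.castSucc_lt_last _).ne]
          · simp only [ha, hb, dif_neg, not_false_eq_true]
            intro e
            exact C.valid (v := ⟨a, by simpa using ha⟩) (w := ⟨b, by simpa using hb⟩)
              (by simpa using hab) (Fin.castSucc_injective _ e)
        · intro u hu
          by_contra h
          simp [h, (Fin.castSucc_lt_last _).ne] at hu) hdom hne
      omega
    · push Not at hdom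
      obtain ⟨v, hv⟩ := hdom
      refine ⟨v, fun hcol => hG ?_⟩
      have hmem : ∀ x, x ∈ insert v (G.neighborSet v) := by
        intro x
        by_cases h : x = v
        · left; exact h
        · right; exact hv x h
      obtain ⟨C⟩ := hcol
      exact ⟨SimpleGraph.Coloring.mk (fun x => C ⟨x, hmem x⟩)
        (fun {a b} hab => C.valid (by simpa using hab))⟩

theorem colorable_chromNum {V : Type*} [Finite V] (G : SimpleGraph V) :
    G.Colorable (chromNum G) := by
  have : Fintype V := Fintype.ofFinite V
  exact Nat.sInf_mem (s := {n : ℕ | G.Colorable n}) ⟨_, G.colorable_of_fintype⟩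

end LocCol

/-- For every integer `s ≥ 1`, every finite locally `s`-colourable graph
`G` on `n` vertices satisfies `χ(G) ≤ max {s, ⌊3n/5⌋}`. -/
theorem chromNum_le_max_locallyColourable {V : Type*} [Fintype V]
    (s : ℕ) (hs : 1 ≤ s) (G : SimpleGraph V) (hloc : LocallyColorable G s) :
    chromNum G ≤ max s (3 * Fintype.card V / 5) := by
  by_contra hlt
  push Not at hlt
  rw [max_lt_iff] at hlt
  obtain ⟨h1, h2⟩ := hlt
  obtain ⟨K, hK⟩ : ∃ K, chromNum G = K + 1 := ⟨chromNum G - 1, by omega⟩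
  have hG : ¬ G.Colorable K := by
    intro h
    have : chromNum G ≤ K := Nat.sInf_le h
    omega
  obtain ⟨v, hv⟩ := LocCol.main K _ G rfl hG (by omega)
  exact hv ((LocCol.colorable_chromNum _).mono (by have := hloc v; omega))
end
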